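/- arXiv:2503.06851 — 3 statements merged into one kernel-verified Lean document; each statement's English description precedes it below -/
import Mathlib

section
/- Let T : ℝ^d × 𝒳 → 𝒳 be a continuous action of ℝ^d on a compact metric space (𝒳, 𝐝). Let λ be a Borel probability measure on M^T(𝒳) and let μ = ∫_{M^T(𝒳)} ν dλ(ν) be its barycenter. For every ε > 0, R(𝐝, μ, ε) = inf { ∫_{M^T(𝒳)} R(𝐝, ν, ε_ν) dλ(ν) }, where the infimum is taken over all measurable functions M^T(𝒳) ∋ ν ↦ ε_ν ∈ (0,∞) satisfying ∫_{M^T(𝒳)} ε_ν dλ(ν) ≤ ε. -/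
open MeasureTheory Filter Set
open scoped ENNReal Topology NNReal

noncomputable section

/-- Shannon entropy (base 2) of a finitely-valued random variable. -/
def shannonEntropy {Ω S : Type*} [MeasurableSpace Ω] [Fintype S]
    (P : Measure Ω) (f : Ω → S) : ℝ :=
  -∑ i : S, ((P (f ⁻¹' {i})).toReal * Real.logb 2 ((P (f ⁻¹' {i})).toReal))

/-- Mutual information (base 2) of two random variables, defined as the supremum over all
finite measurable partitions (encoded as measurable maps into `Fin n`) of
`H(α∘X) + H(β∘Y) - H(α∘X, β∘Y)`. -/
def mutualInfo {Ω A B : Type*} [MeasurableSpace Ω] [MeasurableSpace A] [MeasurableSpace B]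
    (P : Measure Ω) (X : Ω → A) (Y : Ω → B) : ℝ≥0∞ :=
  ⨆ (n : ℕ) (m : ℕ) (α : A → Fin n) (_ : Measurable α) (β : B → Fin m) (_ : Measurable β),
    ENNReal.ofReal (shannonEntropy P (fun ω => α (X ω)) + shannonEntropy P (fun ω => β (Y ω))
      - shannonEntropy P (fun ω => (α (X ω), β (Y ω))))

/-- The box `[0,L)^d ⊆ ℝ^d`. -/
def unitBox (d : ℕ) (L : ℝ) : Set (Fin d → ℝ) := Set.univ.pi fun _ => Set.Ico (0 : ℝ) L

/-- Lebesgue measure on `ℝ^d` restricted to the box `[0,L)^d`. -/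
def boxMeasure (d : ℕ) (L : ℝ) : Measure (Fin d → ℝ) := volume.restrict (unitBox d L)

/-- The space `L¹([0,L)^d, X)` of measurable maps modulo a.e. equality. -/
abbrev L1Maps (d : ℕ) (L : ℝ) (X : Type*) [TopologicalSpace X] :=
  (Fin d → ℝ) →ₘ[boxMeasure d L] X

/-- The `L¹` distance `D(f,g) = ∫_{[0,L)^d} 𝐝(f(u), g(u)) dm(u)`. -/
def L1dist {d : ℕ} {L : ℝ} {X : Type*} [MetricSpace X] (f g : L1Maps d L X) : ℝ :=
  ∫ u, dist (f u) (g u) ∂(boxMeasure d L)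

/-- The Borel σ-algebra of the metric `L1dist` on `L¹([0,L)^d, X)`,
generated by the open balls of the metric. -/
instance L1Maps.measurableSpace {d : ℕ} {L : ℝ} {X : Type*} [MetricSpace X] :
    MeasurableSpace (L1Maps d L X) :=
  MeasurableSpace.generateFrom {s | ∃ (f : L1Maps d L X) (r : ℝ), s = {g | L1dist f g < r}}

/-- The expected mean distortion `E[(1/L^d) ∫_{[0,L)^d} 𝐝(T^u X, Y_u) dm(u)]`. -/
def distortion {X : Type*} [MetricSpace X] (d : ℕ) (T : (Fin d → ℝ) → X → X) (L : ℝ)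
    {Ω : Type*} [MeasurableSpace Ω] (P : Measure Ω) (Xv : Ω → X) (Yv : Ω → L1Maps d L X) : ℝ :=
  ∫ ω, (L ^ d)⁻¹ * ∫ u, dist (T u (Xv ω)) (Yv ω u) ∂(boxMeasure d L) ∂P

/-- `R_L(𝐝, μ, ε)`: the infimum of `I(X;Y)` over all pairs of random variables on a common
probability space with `Law X = μ`, `Y` taking values in `L¹([0,L)^d, X)` and expected mean
distortion `< ε`. -/
def RL {X : Type*} [MetricSpace X] [MeasurableSpace X] (d : ℕ)
    (T : (Fin d → ℝ) → X → X) (μ : Measure X) (L ε : ℝ) : ℝ≥0∞ :=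
  ⨅ (Ω : Type) (_ : MeasurableSpace Ω) (P : Measure Ω) (_ : IsProbabilityMeasure P)
    (Xv : Ω → X) (Yv : Ω → L1Maps d L X) (_ : Measurable Xv) (_ : Measurable Yv)
    (_ : Measure.map Xv P = μ) (_ : distortion d T L P Xv Yv < ε),
    mutualInfo P Xv Yv

/-- The rate distortion function `R(𝐝, μ, ε) = lim_{L→∞} R_L(𝐝, μ, ε)/L^d`, which exists and
equals `inf_{L>0} R_L(𝐝, μ, ε)/L^d`. -/
def RD {X : Type*} [MetricSpace X] [MeasurableSpace X] (d : ℕ)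
    (T : (Fin d → ℝ) → X → X) (μ : Measure X) (ε : ℝ) : ℝ≥0∞ :=
  ⨅ (L : ℝ) (_ : 0 < L), RL d T μ L ε / ENNReal.ofReal (L ^ d)

/-- Upper rate distortion dimension. -/
def urdim {X : Type*} [MetricSpace X] [MeasurableSpace X] (d : ℕ)
    (T : (Fin d → ℝ) → X → X) (μ : Measure X) : ℝ≥0∞ :=
  Filter.limsup (fun ε : ℝ => RD d T μ ε / ENNReal.ofReal (Real.logb 2 (1 / ε))) (𝓝[>] (0 : ℝ))

/-- Lower rate distortion dimension. -/
def lrdim {X : Type*} [MetricSpace X] [MeasurableSpace X] (d : ℕ)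
    (T : (Fin d → ℝ) → X → X) (μ : Measure X) : ℝ≥0∞ :=
  Filter.liminf (fun ε : ℝ => RD d T μ ε / ENNReal.ofReal (Real.logb 2 (1 / ε))) (𝓝[>] (0 : ℝ))

/-- `μ` is invariant under the `ℝ^d`-action `T`. -/
def MeasInvariant {X : Type*} [MeasurableSpace X] (d : ℕ)
    (T : (Fin d → ℝ) → X → X) (μ : Measure X) : Prop :=
  ∀ u : Fin d → ℝ, Measure.map (T u) μ = μ

/-- `T` is a continuous action of the additive group `ℝ^d`. -/
def IsContAction {X : Type*} [TopologicalSpace X] (d : ℕ) (T : (Fin d → ℝ) → X → X) : Prop :=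
  Continuous (fun p : (Fin d → ℝ) × X => T p.1 p.2) ∧ (∀ x, T 0 x = x) ∧
    ∀ u v x, T (u + v) x = T u (T v x)

/-- The metric `𝐝_L(x,y) = sup_{u ∈ [0,L)^d} 𝐝(T^u x, T^u y)`. -/
def dSup {X : Type*} [MetricSpace X] (d : ℕ) (T : (Fin d → ℝ) → X → X) (L : ℝ) (x y : X) : ℝ :=
  ⨆ u : unitBox d L, dist (T u.1 x) (T u.1 y)

/-- The `ε`-covering number of `X` for the (pre)metric `ρ`: the minimal number of open sets
of `ρ`-diameter `< ε` covering `X`. -/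
def covNum (X : Type*) [TopologicalSpace X] (ρ : X → X → ℝ) (ε : ℝ) : ℕ :=
  sInf {n : ℕ | ∃ F : Finset (Set X), F.card = n ∧
    (∀ U ∈ F, IsOpen U ∧ (⨆ x ∈ U, ⨆ y ∈ U, ENNReal.ofReal (ρ x y)) < ENNReal.ofReal ε) ∧
    ⋃₀ (F : Set (Set X)) = Set.univ}

/-- The entropy at scale `ε`: `S(X,T,𝐝,ε) = lim_{L→∞} log₂ #(X, 𝐝_L, ε) / L^d`
(the limit exists, hence equals the limsup used here). -/
def entScale {X : Type*} [MetricSpace X] (d : ℕ) (T : (Fin d → ℝ) → X → X) (ε : ℝ) : ℝ≥0∞ :=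
  Filter.limsup
    (fun L : ℝ => ENNReal.ofReal (Real.logb 2 (covNum X (dSup d T L) ε) / L ^ d)) Filter.atTop

/-- The upper metric mean dimension. -/
def umdim {X : Type*} [MetricSpace X] (d : ℕ) (T : (Fin d → ℝ) → X → X) : ℝ≥0∞ :=
  Filter.limsup (fun ε : ℝ => entScale d T ε / ENNReal.ofReal (Real.logb 2 (1 / ε))) (𝓝[>] (0 : ℝ))

/-- The σ-algebra on the space of Borel probability measures on `X` (for a compact metric `X`
this is the Borel σ-algebra of the weak* topology). -/
instance ProbabilityMeasure.measurableSpace' {α : Type*} [MeasurableSpace α] :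
    MeasurableSpace (ProbabilityMeasure α) :=
  inferInstanceAs (MeasurableSpace {μ : Measure α // IsProbabilityMeasure μ})

/-- The space `M^T(X)` of `T`-invariant Borel probability measures on `X`. -/
abbrev InvM (X : Type*) [MeasurableSpace X] [MetricSpace X] (d : ℕ)
    (T : (Fin d → ℝ) → X → X) :=
  {ν : ProbabilityMeasure X // MeasInvariant d T (ν : Measure X)}

end

lemma RDh.ent_eq {Ω S₁ S₂ : Type*} [MeasurableSpace Ω] [Fintype S₁] [Fintype S₂]
    [MeasurableSpace S₁] [MeasurableSpace S₂] [MeasurableSingletonClass S₁]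
    [MeasurableSingletonClass S₂]
    (P : Measure Ω) [IsProbabilityMeasure P] (f : Ω → S₁) (g : Ω → S₂)
    (hf : Measurable f) (hg : Measurable g) :
    shannonEntropy P f + shannonEntropy P g - shannonEntropy P (fun ω => (f ω, g ω)) =
      (∑ a, ∑ b, P.real (f ⁻¹' {a} ∩ g ⁻¹' {b}) *
        (Real.log (P.real (f ⁻¹' {a} ∩ g ⁻¹' {b})) - Real.log (P.real (f ⁻¹' {a}))
          - Real.log (P.real (g ⁻¹' {b})))) / Real.log 2 := by
  have hfa : ∀ a, MeasurableSet (f ⁻¹' {a}) := fun a => hf (measurableSet_singleton a)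
  have hgb : ∀ b, MeasurableSet (g ⁻¹' {b}) := fun b => hg (measurableSet_singleton b)
  have h1 : ∀ a, P.real (f ⁻¹' {a}) = ∑ b, P.real (f ⁻¹' {a} ∩ g ⁻¹' {b}) := by
    intro a
    rw [← measureReal_biUnion_finset]
    · congr 1
      ext ω; simp
    · intro b _ b' _ hbb
      refine Set.disjoint_left.2 ?_
      rintro ω ⟨_, h⟩ ⟨_, h'⟩
      exact hbb (h.symm.trans h')
    · intro b _
      exact (hfa a).inter (hgb b)
  have h2 : ∀ b, P.real (g ⁻¹' {b}) = ∑ a, P.real (f ⁻¹' {a} ∩ g ⁻¹' {b}) := by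
    intro a
    rw [← measureReal_biUnion_finset]
    · congr 1
      ext ω; simp
    · intro b _ b' _ hbb
      refine Set.disjoint_left.2 ?_
      rintro ω ⟨h, _⟩ ⟨h', _⟩
      exact hbb (h.symm.trans h')
    · intro b _
      exact (hfa b).inter (hgb a)
  have h3 : ∀ a b, (fun ω => (f ω, g ω)) ⁻¹' {(a, b)} = f ⁻¹' {a} ∩ g ⁻¹' {b} := by
    intro a b; ext ω; simp
  have e1 : shannonEntropy P f = -(∑ a, ∑ b, P.real (f ⁻¹' {a} ∩ g ⁻¹' {b}) *
      Real.log (P.real (f ⁻¹' {a}))) / Real.log 2 := by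
    unfold shannonEntropy
    rw [neg_div, Finset.sum_div]
    congr 1
    refine Finset.sum_congr rfl fun a _ => ?_
    rw [← Finset.sum_mul, ← h1, Real.logb, mul_div_assoc]
    rfl
  have e2 : shannonEntropy P g = -(∑ a, ∑ b, P.real (f ⁻¹' {a} ∩ g ⁻¹' {b}) *
      Real.log (P.real (g ⁻¹' {b}))) / Real.log 2 := by
    unfold shannonEntropy
    rw [neg_div, Finset.sum_comm, Finset.sum_div]
    congr 1
    refine Finset.sum_congr rfl fun a _ => ?_
    rw [← Finset.sum_mul, ← h2, Real.logb, mul_div_assoc]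
    rfl
  have e3 : shannonEntropy P (fun ω => (f ω, g ω)) =
      -(∑ a, ∑ b, P.real (f ⁻¹' {a} ∩ g ⁻¹' {b}) *
      Real.log (P.real (f ⁻¹' {a} ∩ g ⁻¹' {b}))) / Real.log 2 := by
    unfold shannonEntropy
    rw [neg_div, Finset.sum_div, Fintype.sum_prod_type]
    congr 1
    refine Finset.sum_congr rfl fun a _ => ?_
    rw [Finset.sum_div]
    refine Finset.sum_congr rfl fun b _ => ?_
    rw [h3, Real.logb, mul_div_assoc]
    rfl
  rw [e1, e2, e3]
  simp only [mul_sub, Finset.sum_sub_distrib]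
  ring

lemma RDh.klog_eq {k w : ℝ} (h : w = 0 → k = 0) :
    k * Real.log (k / w) = k * Real.log k - k * Real.log w := by
  by_cases hk : k = 0
  · simp [hk]
  · have hw : w ≠ 0 := fun h' => hk (h h')
    rw [Real.log_div hk hw, mul_sub]

lemma RDh.abs_klogk {k : ℝ} (h0 : 0 ≤ k) (h1 : k ≤ 1) : |k * Real.log k| ≤ 1 := by
  rcases h0.eq_or_lt with h | h
  · simp [← h]
  · rw [mul_comm]; exact (Real.abs_log_mul_self_lt k h h1).le

lemma RDh.abs_klog {k w : ℝ} (h0 : 0 ≤ k) (h1 : k ≤ 1) (h : w = 0 → k = 0) :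
    |k * Real.log (k / w)| ≤ 1 + |Real.log w| := by
  rw [RDh.klog_eq h]
  refine (abs_sub _ _).trans (add_le_add (RDh.abs_klogk h0 h1) ?_)
  rw [abs_mul, abs_of_nonneg h0]
  exact mul_le_of_le_one_left (abs_nonneg _) h1

lemma RDh.klog_ge {k w G : ℝ} (h0 : 0 ≤ k) (hw : 0 ≤ w) (hG : 0 < G) (h : w = 0 → k = 0) :
    k * Real.log G + k - w * G ≤ k * Real.log (k / w) := by
  rcases h0.eq_or_lt with hk | hk
  · simp [← hk]; positivity
  · have hw' : 0 < w := hw.lt_of_ne fun h' => hk.ne' (h h'.symm)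
    have := Real.add_one_le_exp (Real.log (w * G / k))
    rw [Real.exp_log (by positivity), Real.log_div (by positivity) hk.ne',
      Real.log_mul hw'.ne' hG.ne'] at this
    rw [Real.log_div hk.ne' hw'.ne']
    have h2 := mul_le_mul_of_nonneg_left this hk.le
    have h3 : k * (w * G / k) = w * G := by field_simp
    rw [h3] at h2
    linarith

lemma RDh.measurable_klog {A : Type*} [MeasurableSpace A] {κ : A → ℝ} (hκ : Measurable κ) (w : ℝ) :
    Measurable fun x => κ x * Real.log (κ x / w) :=
  hκ.mul (Real.measurable_log.comp (hκ.div_const w))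

lemma RDh.integrable_of_bdd {A : Type*} [MeasurableSpace A] {M : Measure A} [IsFiniteMeasure M]
    {f : A → ℝ} (hf : Measurable f) (C : ℝ) (h : ∀ x, |f x| ≤ C) : Integrable f M :=
  Integrable.of_bound hf.aestronglyMeasurable C (ae_of_all _ h)

lemma RDh.mutualInfo_le {Ω A B S : Type*} [MeasurableSpace Ω] [MeasurableSpace A]
    [MeasurableSpace B] [Fintype S]
    (P : Measure Ω) [IsProbabilityMeasure P] (Xv : Ω → A) (Yv : Ω → B)
    (hXv : Measurable Xv) (hYv : Measurable Yv) (Ys : S → B) (M : S → Measure A)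
    (μ : Measure A) [IsProbabilityMeasure μ] (hM : ∀ s, M s ≤ μ) (κ : S → A → ℝ)
    (hκm : ∀ s, Measurable (κ s)) (hκ0 : ∀ s x, 0 ≤ κ s x) (hκ1 : ∀ s x, κ s x ≤ 1)
    (W : S → ℝ) (hW0 : ∀ s, 0 ≤ W s) (hW1 : ∑ s, W s ≤ 1)
    (hac : ∀ s x, W s = 0 → κ s x = 0)
    (hX : P.map Xv = μ)
    (hjoint : ∀ U V, MeasurableSet U → MeasurableSet V → P.real (Xv ⁻¹' U ∩ Yv ⁻¹' V) =
      ∑ s, V.indicator (fun _ => (1 : ℝ)) (Ys s) * ∫ x in U, κ s x ∂M s) :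
    mutualInfo P Xv Yv ≤ ENNReal.ofReal
      ((∑ s, ∫ x, κ s x * Real.log (κ s x / W s) ∂M s) / Real.log 2) := by
  have hfin : ∀ s, IsFiniteMeasure (M s) := fun s => isFiniteMeasure_of_le μ (hM s)
  unfold mutualInfo
  refine iSup_le fun n => iSup_le fun m => iSup_le fun α => iSup_le fun hα => iSup_le fun β =>
    iSup_le fun hβ => ENNReal.ofReal_le_ofReal ?_
  rw [RDh.ent_eq P (fun ω => α (Xv ω)) (fun ω => β (Yv ω)) (hα.comp hXv) (hβ.comp hYv)]
  refine div_le_div_of_nonneg_right ?_ (Real.log_nonneg (by norm_num))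
  set p : Fin n → Fin m → ℝ := fun a b =>
    P.real ((fun ω => α (Xv ω)) ⁻¹' {a} ∩ (fun ω => β (Yv ω)) ⁻¹' {b}) with hp
  set pa : Fin n → ℝ := fun a => P.real ((fun ω => α (Xv ω)) ⁻¹' {a}) with hpa
  set pb : Fin m → ℝ := fun b => P.real ((fun ω => β (Yv ω)) ⁻¹' {b}) with hpb
  have hαa : ∀ a, MeasurableSet (α ⁻¹' {a}) := fun a => hα (measurableSet_singleton a)
  have hβb : ∀ b, MeasurableSet (β ⁻¹' {b}) := fun b => hβ (measurableSet_singleton b)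
  have hpj : ∀ a b, p a b = ∑ s, (β ⁻¹' {b}).indicator (fun _ => (1 : ℝ)) (Ys s) *
      ∫ x in α ⁻¹' {a}, κ s x ∂M s := fun a b =>
    hjoint (α ⁻¹' {a}) (β ⁻¹' {b}) (hαa a) (hβb b)
  have hpaμ : ∀ a, pa a = μ.real (α ⁻¹' {a}) := by
    intro a
    rw [← hX, map_measureReal_apply hXv (hαa a)]; rfl
  have hp0 : ∀ a b, 0 ≤ p a b := fun a b => measureReal_nonneg
  have hple_a : ∀ a b, p a b ≤ pa a := fun a b => measureReal_mono inter_subset_left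
  have hple_b : ∀ a b, p a b ≤ pb b := fun a b => measureReal_mono inter_subset_right
  set F : S → Fin n → ℝ := fun s a => ∫ x in α ⁻¹' {a}, κ s x * Real.log (κ s x / W s) ∂M s
    with hF
  set ind : Fin m → S → ℝ := fun b s => (β ⁻¹' {b}).indicator (fun _ => (1 : ℝ)) (Ys s) with hind
  have hind0 : ∀ b s, 0 ≤ ind b s := fun b s =>
    indicator_nonneg (fun _ _ => zero_le_one) _
  have hind1 : ∀ s, ∑ b, ind b s = 1 := by
    intro s
    rw [Finset.sum_eq_single (β (Ys s))]
    · exact indicator_of_mem (by simp) _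
    · intro b _ hb
      exact indicator_of_notMem (by simpa using hb.symm) _
    · simp
  have hκi : ∀ s, Integrable (κ s) (M s) := fun s =>
    RDh.integrable_of_bdd (hκm s) 1 fun x => by rw [abs_of_nonneg (hκ0 s x)]; exact hκ1 s x
  have hLi : ∀ s, Integrable (fun x => κ s x * Real.log (κ s x / W s)) (M s) := fun s =>
    RDh.integrable_of_bdd (RDh.measurable_klog (hκm s) _) _ fun x =>
      RDh.abs_klog (hκ0 s x) (hκ1 s x) (hac s x)
  -- key inequality
  have key : ∀ a b G, 0 < G → (Real.log G + 1) * p a b - G * pa a * ∑ s, ind b s * W s ≤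
      ∑ s, ind b s * F s a := by
    intro a b G hG
    rw [hpj, Finset.mul_sum, Finset.mul_sum, ← Finset.sum_sub_distrib]
    refine Finset.sum_le_sum fun s _ => ?_
    have h1 : (Real.log G + 1) * (∫ x in α ⁻¹' {a}, κ s x ∂M s) - G * pa a * W s ≤ F s a := by
      have h2 : ∫ x in α ⁻¹' {a}, (κ s x * (Real.log G + 1) - W s * G) ∂M s ≤ F s a := by
        refine integral_mono (((hκi s).mul_const _).sub (integrable_const _)).integrableOn
          (hLi s).integrableOn fun x => ?_
        have := RDh.klog_ge (hκ0 s x) (hW0 s) hG (hac s x)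
        simp only at this ⊢
        linarith
      rw [integral_sub ((hκi s).mul_const _).integrableOn (integrable_const _).integrableOn,
        integral_mul_const, setIntegral_const] at h2
      have h3 : (M s).real (α ⁻¹' {a}) ≤ pa a := by
        rw [hpaμ]
        exact ENNReal.toReal_mono (measure_ne_top _ _) (hM s _)
      have h4 := mul_le_mul_of_nonneg_right h3 (mul_nonneg (hW0 s) hG.le)
      simp only [smul_eq_mul] at h2
      linarith
    calc _ = ind b s * ((Real.log G + 1) * (∫ x in α ⁻¹' {a}, κ s x ∂M s) - G * pa a * W s) := by
          simp only [hind]; ring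
      _ ≤ _ := mul_le_mul_of_nonneg_left h1 (hind0 b s)
  have cell : ∀ a b, p a b * (Real.log (p a b) - Real.log (pa a) - Real.log (pb b)) ≤
      ∑ s, ind b s * F s a + (p a b / pb b) * (∑ s, ind b s * W s) - p a b := by
    intro a b
    rcases (hp0 a b).eq_or_lt with h | h
    · rw [← h]
      simp only [zero_mul, zero_div, add_zero, sub_zero]
      set C := pa a * ∑ s, ind b s * W s with hC
      have hC0 : 0 ≤ C := mul_nonneg measureReal_nonneg
        (Finset.sum_nonneg fun s _ => mul_nonneg (hind0 b s) (hW0 s))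
      refine le_of_forall_pos_le_add fun e he => ?_
      have := key a b (e / (C + 1)) (by positivity)
      rw [← h, mul_zero, zero_sub, mul_assoc, ← hC] at this
      have h2 : e / (C + 1) * C ≤ e := by
        rw [div_mul_eq_mul_div, div_le_iff₀ (by positivity)]; nlinarith
      linarith
    · have hpa0 : 0 < pa a := h.trans_le (hple_a a b)
      have hpb0 : 0 < pb b := h.trans_le (hple_b a b)
      have := key a b (p a b / (pa a * pb b)) (by positivity)
      rw [Real.log_div h.ne' (by positivity), Real.log_mul hpa0.ne' hpb0.ne'] at this
      have h2 : p a b / (pa a * pb b) * pa a = p a b / pb b := by field_simp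
      rw [h2] at this
      linarith
  have hsum1 : ∑ a, ∑ b, p a b = 1 := by
    have h1 : ∀ b, ∑ a, p a b = pb b := by
      intro b
      rw [hpb, hp]
      simp only
      rw [← measureReal_biUnion_finset]
      · congr 1
        ext ω; simp
      · intro b _ b' _ hbb
        refine Set.disjoint_left.2 ?_
        rintro ω ⟨h, _⟩ ⟨h', _⟩
        exact hbb (h.symm.trans h')
      · intro a _
        exact (hXv (hαa a)).inter (hYv (hβb b))
    rw [Finset.sum_comm, Finset.sum_congr rfl fun b _ => h1 b, hpb]
    rw [← measureReal_biUnion_finset]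
    · have : (⋃ b ∈ Finset.univ, (fun ω => β (Yv ω)) ⁻¹' {b}) = univ := by ext ω; simp
      rw [this]; simp
    · intro b _ b' _ hbb
      refine Set.disjoint_left.2 ?_
      intro ω h h'
      exact hbb (h.symm.trans h')
    · intro b _
      exact hYv (hβb b)
  have hpbs : ∀ b, ∑ a, p a b / pb b ≤ 1 := by
    intro b
    rw [← Finset.sum_div]
    refine div_le_one_of_le₀ ?_ measureReal_nonneg
    rw [hp]
    simp only
    rw [← measureReal_biUnion_finset]
    · refine measureReal_mono ?_
      intro ω; simp
    · intro b _ b' _ hbb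
      refine Set.disjoint_left.2 ?_
      rintro ω ⟨h, _⟩ ⟨h', _⟩
      exact hbb (h.symm.trans h')
    · intro a _
      exact (hXv (hαa a)).inter (hYv (hβb b))
  calc ∑ a, ∑ b, p a b * (Real.log (p a b) - Real.log (pa a) - Real.log (pb b))
      ≤ ∑ a, ∑ b, (∑ s, ind b s * F s a + (p a b / pb b) * (∑ s, ind b s * W s) - p a b) :=
        Finset.sum_le_sum fun a _ => Finset.sum_le_sum fun b _ => cell a b
    _ = ∑ a, ∑ b, ∑ s, ind b s * F s a + ∑ b, (∑ a, p a b / pb b) * (∑ s, ind b s * W s) - 1 := by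
        simp only [Finset.sum_sub_distrib, Finset.sum_add_distrib, hsum1]
        congr 2
        rw [Finset.sum_comm]
        exact Finset.sum_congr rfl fun b _ => (Finset.sum_mul _ _ _).symm
    _ ≤ ∑ a, ∑ b, ∑ s, ind b s * F s a + ∑ b, 1 * (∑ s, ind b s * W s) - 1 := by
        gcongr with b
        · exact Finset.sum_nonneg fun s _ => mul_nonneg (hind0 b s) (hW0 s)
        · exact hpbs b
    _ = ∑ s, ∑ a, F s a + ∑ s, W s - 1 := by
        congr 2
        · rw [Finset.sum_comm]
          rw [Finset.sum_congr rfl fun b _ => Finset.sum_comm, Finset.sum_comm]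
          refine Finset.sum_congr rfl fun s _ => ?_
          rw [Finset.sum_comm]
          refine Finset.sum_congr rfl fun a _ => ?_
          rw [← Finset.sum_mul, hind1, one_mul]
        · simp only [one_mul]
          rw [Finset.sum_comm]
          refine Finset.sum_congr rfl fun s _ => ?_
          rw [← Finset.sum_mul, hind1, one_mul]
    _ ≤ ∑ s, ∑ a, F s a := by linarith
    _ = _ := by
        refine Finset.sum_congr rfl fun s _ => ?_
        rw [hF]
        simp only
        rw [← integral_iUnion_fintype hαa]
        · have : (⋃ a, α ⁻¹' {a}) = univ := by ext ω; simp
          rw [this, setIntegral_univ]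
        · intro b b' hbb
          refine Set.disjoint_left.2 ?_
          intro ω h h'
          exact hbb (h.symm.trans h')
        · exact fun a => (hLi s).integrableOn

/-- The cost of representing the orbit of `x` by `y`. -/
noncomputable def RDh.cst {X : Type*} [MetricSpace X] {d : ℕ} (T : (Fin d → ℝ) → X → X) (L : ℝ)
    (x : X) (y : (Fin d → ℝ) → X) : ℝ :=
  ∫ u, dist (T u x) (y u) ∂boxMeasure d L

lemma RDh.measurableSet_box (d : ℕ) (L : ℝ) : MeasurableSet (unitBox d L) :=
  MeasurableSet.univ_pi fun _ => measurableSet_Ico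

lemma RDh.volume_box (d : ℕ) {L : ℝ} : volume (unitBox d L) = ENNReal.ofReal L ^ d := by
  unfold unitBox
  rw [Real.volume_pi_Ico]; simp

instance RDh.finite_box (d : ℕ) (L : ℝ) : IsFiniteMeasure (boxMeasure d L) := by
  refine ⟨?_⟩
  rw [boxMeasure, Measure.restrict_apply_univ, RDh.volume_box]
  exact ENNReal.pow_lt_top ENNReal.ofReal_lt_top

lemma RDh.real_box (d : ℕ) {L : ℝ} (hL : 0 ≤ L) : (boxMeasure d L).real univ = L ^ d := by
  rw [measureReal_def, boxMeasure, Measure.restrict_apply_univ, RDh.volume_box,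
    ENNReal.toReal_pow, ENNReal.toReal_ofReal hL]

lemma RDh.dist_le {X : Type*} [MetricSpace X] [CompactSpace X] (x y : X) :
    dist x y ≤ Metric.diam (univ : Set X) :=
  Metric.dist_le_diam_of_mem isCompact_univ.isBounded (mem_univ _) (mem_univ _)

lemma RDh.cst_nonneg {X : Type*} [MetricSpace X] {d : ℕ} (T : (Fin d → ℝ) → X → X) (L : ℝ)
    (x : X) (y : (Fin d → ℝ) → X) : 0 ≤ RDh.cst T L x y :=
  integral_nonneg fun _ => dist_nonneg

lemma RDh.cst_le {X : Type*} [MetricSpace X] [CompactSpace X] {d : ℕ} (T : (Fin d → ℝ) → X → X)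
    {L : ℝ} (hL : 0 ≤ L) (x : X) (y : (Fin d → ℝ) → X) :
    RDh.cst T L x y ≤ Metric.diam (univ : Set X) * L ^ d := by
  unfold RDh.cst
  calc _ ≤ ∫ u, Metric.diam (univ : Set X) ∂boxMeasure d L :=
        integral_mono_of_nonneg (ae_of_all _ fun _ => dist_nonneg) (integrable_const _)
          (ae_of_all _ fun _ => RDh.dist_le _ _)
    _ = _ := by rw [integral_const, RDh.real_box d hL, smul_eq_mul, mul_comm]

lemma RDh.orb_meas {X : Type*} [MetricSpace X] {d : ℕ} {T : (Fin d → ℝ) → X → X}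
    (hT : IsContAction d T) (x : X) : Continuous fun u => T u x :=
  hT.1.comp (by fun_prop : Continuous fun u : Fin d → ℝ => (u, x))

lemma RDh.cst_integrable {X : Type*} [MetricSpace X] [CompactSpace X] {d : ℕ}
    {T : (Fin d → ℝ) → X → X} (hT : IsContAction d T) {L : ℝ} (x : X) {y : (Fin d → ℝ) → X}
    (hy : AEStronglyMeasurable y (boxMeasure d L)) :
    Integrable (fun u => dist (T u x) (y u)) (boxMeasure d L) := by
  refine Integrable.of_bound ((RDh.orb_meas hT x).aestronglyMeasurable.dist hy)
    (Metric.diam (univ : Set X)) (ae_of_all _ fun u => ?_)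
  rw [Real.norm_of_nonneg dist_nonneg]
  exact RDh.dist_le _ _

lemma RDh.cst_cont {X : Type*} [MetricSpace X] [CompactSpace X] {d : ℕ}
    {T : (Fin d → ℝ) → X → X} (hT : IsContAction d T) {L : ℝ} {y : (Fin d → ℝ) → X}
    (hy : AEStronglyMeasurable y (boxMeasure d L)) :
    Continuous fun x => RDh.cst T L x y := by
  unfold RDh.cst
  refine continuous_of_dominated (bound := fun _ => Metric.diam (univ : Set X))
    (fun x => (RDh.cst_integrable hT x hy).aestronglyMeasurable) (fun x => ae_of_all _ fun u => ?_)
    (integrable_const _) (ae_of_all _ fun u => ?_)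
  · rw [Real.norm_of_nonneg dist_nonneg]
    exact RDh.dist_le _ _
  · exact (hT.1.comp (by fun_prop : Continuous fun x : X => (u, x))).dist continuous_const

lemma RDh.RL_le {X : Type*} [MetricSpace X] [CompactSpace X] [MeasurableSpace X] [BorelSpace X]
    {d : ℕ} {T : (Fin d → ℝ) → X → X} (hT : IsContAction d T) {L : ℝ} (hL : 0 < L)
    {S : Type} [Fintype S] (Ys : S → L1Maps d L X) (M : S → Measure X)
    (μ : Measure X) [IsProbabilityMeasure μ] (hM : ∀ s, M s ≤ μ) (κ : S → X → ℝ)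
    (hκm : ∀ s, Measurable (κ s)) (hκ0 : ∀ s x, 0 ≤ κ s x) (hκ1 : ∀ s x, κ s x ≤ 1)
    (W : S → ℝ) (hW0 : ∀ s, 0 ≤ W s) (hW1 : ∑ s, W s ≤ 1)
    (hac : ∀ s x, W s = 0 → κ s x = 0)
    (hsum : ∀ U, MeasurableSet U → ∑ s, ∫ x in U, κ s x ∂M s = μ.real U)
    (ε : ℝ) (hdist : ∑ s, ∫ x, κ s x * RDh.cst T L x (Ys s) ∂M s < ε * L ^ d) :
    RL d T μ L ε ≤ ENNReal.ofReal
      ((∑ s, ∫ x, κ s x * Real.log (κ s x / W s) ∂M s) / Real.log 2) := by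
  have hfin : ∀ s, IsFiniteMeasure (M s) := fun s => isFiniteMeasure_of_le μ (hM s)
  have hne : Nonempty X := nonempty_of_isProbabilityMeasure μ
  obtain ⟨e, he⟩ := exists_measurableEmbedding_real X
  set g := he.invFun with hg
  have hgm : Measurable g := he.measurable_invFun
  have hge : ∀ x, g (e x) = x := he.leftInverse_invFun
  let _ : MeasurableSpace S := ⊤
  have : DiscreteMeasurableSpace S := ⟨fun _ => trivial⟩
  set N : S → Measure X := fun s => (M s).withDensity (fun x => ENNReal.ofReal (κ s x)) with hN
  have hem : ∀ s : S, Measurable fun x => (e x, s) := fun s => he.measurable.prodMk measurable_const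
  set P : Measure (ℝ × S) := ∑ s, (N s).map (fun x => (e x, s)) with hP
  have hκi : ∀ s, Integrable (κ s) (M s) := fun s =>
    RDh.integrable_of_bdd (hκm s) 1 fun x => by rw [abs_of_nonneg (hκ0 s x)]; exact hκ1 s x
  have hNr : ∀ s U, MeasurableSet U → N s U = ENNReal.ofReal (∫ x in U, κ s x ∂M s) := by
    intro s U hU
    rw [hN, withDensity_apply _ hU,
      ofReal_integral_eq_lintegral_ofReal (hκi s).integrableOn (ae_of_all _ (hκ0 s))]
  have hNfin : ∀ s, IsFiniteMeasure (N s) := fun s => ⟨by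
    rw [hNr s _ MeasurableSet.univ]; exact ENNReal.ofReal_lt_top⟩
  have hPE : ∀ E, MeasurableSet E → P E =
      ENNReal.ofReal (∑ s, ∫ x in (fun x => (e x, s)) ⁻¹' E, κ s x ∂M s) := by
    intro E hE
    rw [hP, Measure.finsetSum_apply, ENNReal.ofReal_sum_of_nonneg]
    · refine Finset.sum_congr rfl fun s _ => ?_
      rw [Measure.map_apply (hem s) hE, hNr s _ (hem s hE)]
    · exact fun s _ => integral_nonneg (hκ0 s)
  have hPp : IsProbabilityMeasure P := ⟨by
    rw [hPE _ MeasurableSet.univ]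
    simp only [preimage_univ]
    rw [hsum _ MeasurableSet.univ]; simp⟩
  set Xv : ℝ × S → X := fun ω => g ω.1 with hXv
  set Yv : ℝ × S → L1Maps d L X := fun ω => Ys ω.2 with hYv
  have hXm : Measurable Xv := hgm.comp measurable_fst
  have hYm : Measurable Yv := (measurable_from_top (f := Ys)).comp measurable_snd
  have hmap : P.map Xv = μ := by
    ext U hU
    rw [Measure.map_apply hXm hU, hPE _ (hXm hU)]
    have : ∀ s, (fun x => (e x, s)) ⁻¹' (Xv ⁻¹' U) = U := by
      intro s; ext x; simp [hXv, hge]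
    simp only [this]
    rw [hsum U hU]; simp
  have hdis : distortion d T L P Xv Yv < ε := by
    unfold distortion
    have hcm : ∀ s, Measurable fun x => RDh.cst T L x (Ys s) := fun s =>
      (RDh.cst_cont hT (Ys s).aestronglyMeasurable).measurable
    have hcb : ∀ s x, |RDh.cst T L x (Ys s)| ≤ Metric.diam (univ : Set X) * L ^ d := by
      intro s x
      rw [abs_of_nonneg (RDh.cst_nonneg _ _ _ _)]
      exact RDh.cst_le T hL.le _ _
    have hgm' : Measurable fun ω : ℝ × S => RDh.cst T L (Xv ω) (Yv ω) :=
      measurable_from_prod_countable_left fun s => (hcm s).comp hgm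
    have h1 : ∫ ω, RDh.cst T L (Xv ω) (Yv ω) ∂P = ∑ s, ∫ x, κ s x * RDh.cst T L x (Ys s) ∂M s := by
      rw [hP, integral_finsetSum_measure]
      · refine Finset.sum_congr rfl fun s _ => ?_
        rw [integral_map (hem s).aemeasurable hgm'.aestronglyMeasurable, hN,
          integral_withDensity_eq_integral_toReal_smul (hκm s).ennreal_ofReal
            (ae_of_all _ fun _ => ENNReal.ofReal_lt_top)]
        refine integral_congr_ae (ae_of_all _ fun x => ?_)
        simp only [hXv, hYv, hge, ENNReal.toReal_ofReal (hκ0 s x), smul_eq_mul]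
      · intro s _
        exact RDh.integrable_of_bdd hgm' _ fun ω => hcb _ _
    have h2 : ∫ ω, (L ^ d)⁻¹ * RDh.cst T L (Xv ω) (Yv ω) ∂P < ε := by
      rw [integral_const_mul, h1, inv_mul_lt_iff₀ (by positivity), mul_comm]
      exact hdist
    exact h2
  refine le_trans ?_ (RDh.mutualInfo_le P Xv Yv hXm hYm Ys M μ hM κ hκm hκ0 hκ1 W hW0 hW1 hac hmap ?_)
  · exact iInf_le_of_le (ℝ × S) <| iInf_le_of_le inferInstance <| iInf_le_of_le P <|
      iInf_le_of_le hPp <| iInf_le_of_le Xv <| iInf_le_of_le Yv <| iInf_le_of_le hXm <|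
      iInf_le_of_le hYm <| iInf_le_of_le hmap <| iInf_le_of_le hdis le_rfl
  · intro U V hU hV
    rw [measureReal_def, hPE _ ((hXm hU).inter (hYm hV)), ENNReal.toReal_ofReal
      (Finset.sum_nonneg fun s _ => integral_nonneg (hκ0 s))]
    refine Finset.sum_congr rfl fun s _ => ?_
    by_cases hs : Ys s ∈ V
    · rw [indicator_of_mem hs, one_mul]
      congr 2
      ext x; simp [hXv, hYv, hge, hs]
    · rw [indicator_of_notMem hs, zero_mul]
      have : (fun x => (e x, s)) ⁻¹' (Xv ⁻¹' U ∩ Yv ⁻¹' V) = ∅ := by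
        ext x; simp [hXv, hYv, hs]
      rw [this]; simp

lemma RDh.sum_pi_one {B M : Type*} [Fintype B] [DecidableEq B] [Fintype M] (k : B → M → ℝ)
    (h : ∀ b, ∑ i, k b i = 1) : ∑ i : B → M, ∏ b, k b (i b) = 1 := by
  have := Finset.prod_univ_sum (fun _ : B => (Finset.univ : Finset M)) k
  rw [Fintype.piFinset_univ] at this
  rw [← this]
  simp [h]

lemma RDh.sum_pi {B M : Type*} [Fintype B] [DecidableEq B] [Fintype M] (k : B → M → ℝ)
    (h : ∀ b, ∑ i, k b i = 1) (g : B → M → ℝ) :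
    ∑ i : B → M, (∏ b, k b (i b)) * ∑ b, g b (i b) = ∑ b, ∑ i, k b i * g b i := by
  simp only [Finset.mul_sum]
  rw [Finset.sum_comm]
  refine Finset.sum_congr rfl fun b0 _ => ?_
  have := Finset.prod_univ_sum (fun _ : B => (Finset.univ : Finset M))
    (fun b i => k b i * if b = b0 then g b0 i else 1)
  rw [Fintype.piFinset_univ] at this
  have h2 : ∀ i : B → M, (∏ b, k b (i b)) * g b0 (i b0) =
      ∏ b, (k b (i b) * if b = b0 then g b0 (i b) else 1) := by
    intro i
    rw [Finset.prod_mul_distrib]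
    congr 1
    rw [Finset.prod_ite_eq' Finset.univ b0 (fun b => g b0 (i b))]
    simp
  rw [Finset.sum_congr rfl fun i _ => h2 i, ← this]
  rw [Finset.prod_eq_single b0]
  · simp
  · intro b _ hb
    simp [hb, h]
  · simp

lemma RDh.block {X : Type*} [MetricSpace X] [CompactSpace X] [MeasurableSpace X] [BorelSpace X]
    {d : ℕ} {T : (Fin d → ℝ) → X → X} (hT : IsContAction d T) {L l : ℝ} (hl : 0 < l) (n : ℕ)
    (hn : n * l ≤ L) (x0 : X) (y : (Fin d → Fin n) → (Fin d → ℝ) → X)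
    (hy : ∀ b, Measurable (y b)) :
    ∃ Y : (Fin d → ℝ) → X, Measurable Y ∧ ∀ x, RDh.cst T L x Y ≤
      ∑ b : Fin d → Fin n, RDh.cst T l (T (fun t => l * (b t : ℕ)) x) (y b)
        + Metric.diam (univ : Set X) * (L ^ d - (n : ℝ) ^ d * l ^ d) := by
  have hL : 0 ≤ L := le_trans (by positivity) hn
  set F : (Fin d → ℕ) × (Fin d → ℝ) → X := fun p =>
    if h : ∀ t, p.1 t < n then y (fun t => ⟨p.1 t, h t⟩) (p.2 - fun t => l * (p.1 t : ℝ)) else x0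
    with hF
  have hFm : Measurable F := by
    refine measurable_from_prod_countable_right fun b => ?_
    by_cases h : ∀ t, b t < n
    · simp only [hF, h, dif_pos, implies_true]
      exact (hy _).comp (measurable_id.sub_const _)
    · simp only [hF, h, dif_neg, not_false_eq_true]
      exact measurable_const
  set idx : (Fin d → ℝ) → Fin d → ℕ := fun u t => ⌊u t / l⌋₊ with hidx
  have hidxm : Measurable idx := by
    refine measurable_pi_lambda _ fun t => ?_
    have h : Measurable fun u : Fin d → ℝ => u t / l := by fun_prop
    exact Nat.measurable_floor.comp h
  set Y : (Fin d → ℝ) → X := fun u => F (idx u, u) with hY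
  have hYm : Measurable Y := hFm.comp (hidxm.prodMk measurable_id)
  refine ⟨Y, hYm, fun x => ?_⟩
  set v : (Fin d → Fin n) → Fin d → ℝ := fun b t => l * (b t : ℕ) with hv
  set box : (Fin d → Fin n) → Set (Fin d → ℝ) := fun b => (fun u => u - v b) ⁻¹' unitBox d l
    with hbox
  have hmp : ∀ b, MeasurePreserving (fun u : Fin d → ℝ => u - v b) volume volume := fun b =>
    measurePreserving_sub_right volume (v b)
  have hboxm : ∀ b, MeasurableSet (box b) := fun b =>
    (hmp b).measurable (RDh.measurableSet_box d l)
  have hmem : ∀ b u, u ∈ box b ↔ ∀ t, l * (b t : ℕ) ≤ u t ∧ u t < l * (b t : ℕ) + l := by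
    intro b u
    simp only [hbox, hv, mem_preimage, unitBox, mem_univ_pi, Pi.sub_apply, mem_Ico]
    refine forall_congr' fun t => ?_
    constructor <;> rintro ⟨h1, h2⟩ <;> constructor <;> linarith
  have hid : ∀ b u, u ∈ box b → ∀ t, idx u t = (b t : ℕ) := by
    intro b u hu t
    obtain ⟨h1, h2⟩ := (hmem b u).1 hu t
    simp only [hidx]
    have h0 : (0 : ℝ) ≤ l * ((b t : ℕ) : ℝ) := by positivity
    rw [Nat.floor_eq_iff (div_nonneg (h0.trans h1) hl.le), le_div_iff₀ hl, div_lt_iff₀ hl]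
    constructor <;> nlinarith
  have hYb : ∀ b u, u ∈ box b → Y u = y b (u - v b) := by
    intro b u hu
    have h1 : idx u = fun t => (b t : ℕ) := funext (hid b u hu)
    simp only [hY, hF, h1]
    rw [dif_pos (fun t => (b t).2)]
  have hdisj : Pairwise (Function.onFun Disjoint box) := by
    intro b b' hbb
    refine Set.disjoint_left.2 fun u hu hu' => hbb ?_
    funext t
    exact Fin.ext ((hid b u hu t).symm.trans (hid b' u hu' t))
  set U := ⋃ b, box b with hU
  have hUm : MeasurableSet U := MeasurableSet.iUnion hboxm
  have hUsub : U ⊆ unitBox d L := by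
    refine iUnion_subset fun b u hu => ?_
    simp only [unitBox, mem_univ_pi, mem_Ico]
    intro t
    obtain ⟨h1, h2⟩ := (hmem b u).1 hu t
    have h0 : (0 : ℝ) ≤ l * ((b t : ℕ) : ℝ) := by positivity
    refine ⟨h0.trans h1, h2.trans_le (le_trans ?_ hn)⟩
    have : ((b t : ℕ) : ℝ) + 1 ≤ n := by exact_mod_cast (b t).2
    nlinarith
  have hvolb : ∀ b, volume (box b) = ENNReal.ofReal l ^ d := fun b => by
    rw [hbox]
    simp only
    rw [(hmp b).measure_preimage (RDh.measurableSet_box d l).nullMeasurableSet, RDh.volume_box]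
  have hvolU : volume.real U = (n : ℝ) ^ d * l ^ d := by
    rw [measureReal_def, hU, measure_iUnion hdisj hboxm, tsum_fintype]
    simp only [hvolb]
    simp [ENNReal.toReal_ofReal hl.le]
  set f : (Fin d → ℝ) → ℝ := fun u => dist (T u x) (Y u) with hf
  have hfi : IntegrableOn f (unitBox d L) volume :=
    RDh.cst_integrable hT x hYm.aestronglyMeasurable
  have h1 : ∫ u in U, f u = ∑ b, RDh.cst T l (T (v b) x) (y b) := by
    rw [hU, integral_iUnion_fintype hboxm hdisj
      (fun b => hfi.mono_set ((subset_iUnion box b).trans hUsub))]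
    refine Finset.sum_congr rfl fun b _ => ?_
    have h2 : ∫ u in box b, f u = ∫ u in box b,
        (fun w => dist (T w (T (v b) x)) (y b w)) (u - v b) := by
      refine setIntegral_congr_fun (hboxm b) fun u hu => ?_
      simp only [hf]
      rw [hYb b u hu, ← hT.2.2, sub_add_cancel]
    rw [h2, hbox]
    simp only
    have h3 := (hmp b).setIntegral_preimage_emb (MeasurableEquiv.subRight (v b)).measurableEmbedding
      (fun w => dist (T w (T (v b) x)) (y b w)) (unitBox d l)
    exact h3
  have h2 : ∫ u in unitBox d L \ U, f u ≤
      Metric.diam (univ : Set X) * (L ^ d - (n : ℝ) ^ d * l ^ d) := by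
    have hfinL : volume (unitBox d L) ≠ ⊤ := by
      rw [RDh.volume_box]; exact ENNReal.pow_ne_top ENNReal.ofReal_ne_top
    have hfinD : volume (unitBox d L \ U) ≠ ⊤ := measure_ne_top_of_subset sdiff_subset hfinL
    have : IsFiniteMeasure (volume.restrict (unitBox d L \ U)) :=
      ⟨by rw [Measure.restrict_apply_univ]; exact hfinD.lt_top⟩
    calc _ ≤ ∫ u in unitBox d L \ U, Metric.diam (univ : Set X) :=
          integral_mono_of_nonneg (ae_of_all _ fun _ => dist_nonneg) (integrable_const _)
            (ae_of_all _ fun _ => RDh.dist_le _ _)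
      _ = _ := by
          rw [setIntegral_const, measureReal_sdiff hUsub hUm
            hfinL, hvolU, measureReal_def, RDh.volume_box,
            ENNReal.toReal_pow, ENNReal.toReal_ofReal hL, smul_eq_mul, mul_comm]
  have h3 : RDh.cst T L x Y = (∫ u in U, f u) + ∫ u in unitBox d L \ U, f u := by
    have := integral_inter_add_sdiff hUm hfi
    rw [inter_eq_self_of_subset_right hUsub] at this
    rw [this]; rfl
  rw [h3, h1]
  exact add_le_add le_rfl h2

/-- A finite-alphabet coding scheme on a box of side `L`. -/
structure RDh.Sch {X : Type*} [MetricSpace X] [MeasurableSpace X] (d : ℕ) where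
  L : ℝ
  hL : 0 < L
  m : ℕ
  k : X → Fin m → ℝ
  hkm : ∀ i, Measurable fun x => k x i
  hk0 : ∀ x i, 0 ≤ k x i
  hk1 : ∀ x, ∑ i, k x i = 1
  q : Fin m → ℝ
  hq0 : ∀ i, 0 ≤ q i
  hq1 : ∑ i, q i = 1
  hac : ∀ x i, q i = 0 → k x i = 0
  y : Fin m → (Fin d → ℝ) → X
  hy : ∀ i, Measurable (y i)

namespace RDh.Sch
variable {X : Type*} [MetricSpace X] [CompactSpace X] [MeasurableSpace X] [BorelSpace X] {d : ℕ}

/-- raw information density -/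
noncomputable def Jr (s : RDh.Sch (X := X) d) (x : X) : ℝ := ∑ i, s.k x i * Real.log (s.k x i / s.q i)

/-- raw distortion -/
noncomputable def Dr (T : (Fin d → ℝ) → X → X) (s : RDh.Sch (X := X) d) (x : X) : ℝ :=
  ∑ i, s.k x i * RDh.cst T s.L x (s.y i)

lemma k_le (s : RDh.Sch (X := X) d) (x : X) (i) : s.k x i ≤ 1 := by
  rw [← s.hk1 x]
  exact Finset.single_le_sum (f := fun i => s.k x i) (fun i _ => s.hk0 x i) (Finset.mem_univ i)

lemma Jr_meas (s : RDh.Sch (X := X) d) : Measurable s.Jr := by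
  unfold Jr
  exact Finset.measurable_sum _ fun i _ => RDh.measurable_klog (s.hkm i) _

lemma Jr_nonneg (s : RDh.Sch (X := X) d) (x : X) : 0 ≤ s.Jr x := by
  have : ∑ i, (s.k x i - s.q i) ≤ s.Jr x := by
    refine Finset.sum_le_sum fun i _ => ?_
    have := RDh.klog_ge (s.hk0 x i) (s.hq0 i) one_pos (s.hac x i)
    simpa using this
  rw [Finset.sum_sub_distrib, s.hk1, s.hq1, sub_self] at this
  exact this

lemma Jr_bdd (s : RDh.Sch (X := X) d) : ∃ C, ∀ x, |s.Jr x| ≤ C :=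
  ⟨∑ i, (1 + |Real.log (s.q i)|), fun x => (Finset.abs_sum_le_sum_abs _ _).trans
    (Finset.sum_le_sum fun i _ => RDh.abs_klog (s.hk0 x i) (s.k_le x i) (s.hac x i))⟩

lemma Jr_int (s : RDh.Sch (X := X) d) (M : Measure X) [IsFiniteMeasure M] : Integrable s.Jr M := by
  obtain ⟨C, hC⟩ := s.Jr_bdd
  exact RDh.integrable_of_bdd s.Jr_meas C hC

lemma Dr_nonneg (T : (Fin d → ℝ) → X → X) (s : RDh.Sch (X := X) d) (x : X) : 0 ≤ s.Dr T x :=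
  Finset.sum_nonneg fun i _ => mul_nonneg (s.hk0 x i) (RDh.cst_nonneg _ _ _ _)

lemma Dr_le (T : (Fin d → ℝ) → X → X) (s : RDh.Sch (X := X) d) (x : X) :
    s.Dr T x ≤ Metric.diam (univ : Set X) * s.L ^ d := by
  calc s.Dr T x ≤ ∑ i, s.k x i * (Metric.diam (univ : Set X) * s.L ^ d) :=
        Finset.sum_le_sum fun i _ => mul_le_mul_of_nonneg_left (RDh.cst_le T s.hL.le _ _) (s.hk0 x i)
    _ = _ := by rw [← Finset.sum_mul, s.hk1, one_mul]

lemma Dr_meas {T : (Fin d → ℝ) → X → X} (hT : IsContAction d T) (s : RDh.Sch (X := X) d) :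
    Measurable (s.Dr T) := by
  unfold Dr
  exact Finset.measurable_sum _ fun i _ =>
    (s.hkm i).mul (RDh.cst_cont hT (s.hy i).aestronglyMeasurable).measurable

lemma Dr_int {T : (Fin d → ℝ) → X → X} (hT : IsContAction d T) (s : RDh.Sch (X := X) d)
    (M : Measure X) [IsFiniteMeasure M] : Integrable (s.Dr T) M :=
  RDh.integrable_of_bdd (s.Dr_meas hT) _ fun x => by
    rw [abs_of_nonneg (s.Dr_nonneg T x)]; exact s.Dr_le T x

end RDh.Sch

lemma RDh.integral_inv {X : Type*} [MeasurableSpace X] {d : ℕ} {T : (Fin d → ℝ) → X → X}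
    {M : Measure X} (hinv : MeasInvariant d T M) (v : Fin d → ℝ) (hTv : Measurable (T v))
    {f : X → ℝ} (hf : Measurable f) : ∫ x, f (T v x) ∂M = ∫ x, f x ∂M := by
  conv_rhs => rw [← hinv v]
  rw [integral_map hTv.aemeasurable hf.aestronglyMeasurable]

lemma RDh.T_meas {X : Type*} [MetricSpace X] [MeasurableSpace X] [BorelSpace X] {d : ℕ}
    {T : (Fin d → ℝ) → X → X} (hT : IsContAction d T) (v : Fin d → ℝ) : Measurable (T v) :=
  (hT.1.comp (by fun_prop : Continuous fun x : X => (v, x))).measurable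

lemma RDh.RL_le_blocks {X : Type*} [MetricSpace X] [CompactSpace X] [MeasurableSpace X]
    [BorelSpace X] {d : ℕ} {T : (Fin d → ℝ) → X → X} (hT : IsContAction d T)
    {ι : Type} [Fintype ι] [Nonempty ι] (s : ι → RDh.Sch (X := X) d) (M : ι → Measure X)
    (μ : Measure X) [IsProbabilityMeasure μ] (hsum : ∑ j, M j = μ)
    (hinv : ∀ j, MeasInvariant d T (M j)) {L : ℝ} (hL : 0 < L) (n : ι → ℕ)
    (hn : ∀ j, n j * (s j).L ≤ L) (ε : ℝ)
    (hdist : ∑ j, ((n j : ℝ) ^ d * ∫ x, (s j).Dr T x ∂M j + Metric.diam (univ : Set X) *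
      (L ^ d - (n j : ℝ) ^ d * (s j).L ^ d) * (M j).real univ) < ε * L ^ d) :
    RL d T μ L ε ≤ ENNReal.ofReal ((Real.log (Fintype.card ι) +
      ∑ j, (n j : ℝ) ^ d * ∫ x, (s j).Jr x ∂M j) / Real.log 2) := by
  classical
  have hM : ∀ j, M j ≤ μ := by
    intro j
    rw [← hsum]
    exact Finset.single_le_sum (f := M) (fun _ _ => Measure.zero_le _) (Finset.mem_univ j)
  have hfin : ∀ j, IsFiniteMeasure (M j) := fun j => isFiniteMeasure_of_le μ (hM j)
  have hne : Nonempty X := nonempty_of_isProbabilityMeasure μ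
  obtain ⟨x0⟩ := hne
  have hblk : ∀ j (i : (Fin d → Fin (n j)) → Fin (s j).m), _ := fun j i =>
    RDh.block hT (s j).hL (n j) (hn j) x0 (fun b => (s j).y (i b)) (fun b => (s j).hy _)
  choose Y hYm hY using hblk
  set v : ∀ j, (Fin d → Fin (n j)) → Fin d → ℝ := fun j b t => (s j).L * (b t : ℕ) with hv
  set N : ℝ := ((Fintype.card ι : ℕ) : ℝ) with hN
  have hN0 : 0 < N := by
    rw [hN]; exact_mod_cast Fintype.card_pos
  set K : ∀ j, X → (Fin d → Fin (n j)) → Fin (s j).m → ℝ := fun j x b i => (s j).k (T (v j b) x) i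
    with hK
  have hK1 : ∀ j x b, ∑ i, K j x b i = 1 := fun j x b => (s j).hk1 _
  have hK0 : ∀ j x b i, 0 ≤ K j x b i := fun j x b i => (s j).hk0 _ _
  have hKac : ∀ j x b i, (s j).q i = 0 → K j x b i = 0 := fun j x b i h => (s j).hac _ _ h
  have hKm : ∀ j b i, Measurable fun x => K j x b i := fun j b i =>
    ((s j).hkm i).comp (RDh.T_meas hT _)
  have hkm : ∀ j (i : (Fin d → Fin (n j)) → Fin (s j).m),
      Measurable fun x => ∏ b, K j x b (i b) := fun j i =>
    Finset.measurable_prod _ fun b _ => hKm j b _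
  have hkle : ∀ j (i : (Fin d → Fin (n j)) → Fin (s j).m) x, ∏ b, K j x b (i b) ≤ 1 :=
    fun j i x => Finset.prod_le_one (fun b _ => hK0 _ _ _ _) fun b _ => (s j).k_le _ _
  have hknn : ∀ j (i : (Fin d → Fin (n j)) → Fin (s j).m) x, 0 ≤ ∏ b, K j x b (i b) :=
    fun j i x => Finset.prod_nonneg (fun b _ => hK0 _ _ _ _)
  have hki : ∀ j (i : (Fin d → Fin (n j)) → Fin (s j).m),
      Integrable (fun x => ∏ b, K j x b (i b)) (M j) := fun j i =>
    RDh.integrable_of_bdd (hkm j i) 1 fun x => by rw [abs_of_nonneg (hknn j i x)]; exact hkle j i x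
  have hpac : ∀ j (i : (Fin d → Fin (n j)) → Fin (s j).m) x, ∏ b, (s j).q (i b) = 0 →
      ∏ b, K j x b (i b) = 0 := by
    intro j i x h
    obtain ⟨b, _, hb⟩ := Finset.prod_eq_zero_iff.1 h
    exact Finset.prod_eq_zero (Finset.mem_univ b) (hKac j x b _ hb)
  have hcard : ∀ j, (Fintype.card (Fin d → Fin (n j)) : ℝ) = (n j : ℝ) ^ d := by
    intro j; simp
  have hdist' : ∑ p : (Σ j, (Fin d → Fin (n j)) → Fin (s j).m),
      ∫ x, (∏ b, K p.1 x b (p.2 b)) *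
        RDh.cst T L x (AEEqFun.mk (Y p.1 p.2) (hYm p.1 p.2).aestronglyMeasurable :
          L1Maps d L X) ∂M p.1 < ε * L ^ d := by
    refine lt_of_le_of_lt ?_ hdist
    rw [Fintype.sum_sigma]
    refine Finset.sum_le_sum fun j _ => ?_
    have hc : ∀ i x, RDh.cst T L x (AEEqFun.mk (Y j i) (hYm j i).aestronglyMeasurable :
        L1Maps d L X) = RDh.cst T L x (Y j i) := by
      intro i x
      refine integral_congr_ae ?_
      filter_upwards [AEEqFun.coeFn_mk (Y j i) (hYm j i).aestronglyMeasurable] with u hu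
      rw [hu]
    simp only [hc]
    rw [← integral_finsetSum]
    · calc _ ≤ ∫ x, (∑ b, (s j).Dr T (T (v j b) x) + Metric.diam (univ : Set X) *
              (L ^ d - (n j : ℝ) ^ d * (s j).L ^ d)) ∂M j := by
            refine integral_mono_of_nonneg (ae_of_all _ fun x => ?_) ?_ (ae_of_all _ fun x => ?_)
            · exact Finset.sum_nonneg fun i _ => mul_nonneg (hknn j i x) (RDh.cst_nonneg _ _ _ _)
            · refine Integrable.add (integrable_finsetSum _ fun b _ => ?_) (integrable_const _)
              refine RDh.integrable_of_bdd (((s j).Dr_meas hT).comp (RDh.T_meas hT (v j b)))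
                (Metric.diam (univ : Set X) * (s j).L ^ d) fun x => ?_
              rw [abs_of_nonneg ((s j).Dr_nonneg T _)]
              exact (s j).Dr_le T _
            · simp only
              have h1 := RDh.sum_pi (K j x) (hK1 j x)
                (fun b i => RDh.cst T (s j).L (T (v j b) x) ((s j).y i))
              have h2 := RDh.sum_pi_one (K j x) (hK1 j x)
              calc _ ≤ ∑ i : (Fin d → Fin (n j)) → Fin (s j).m, (∏ b, K j x b (i b)) *
                    (∑ b, RDh.cst T (s j).L (T (v j b) x) ((s j).y (i b)) +
                      Metric.diam (univ : Set X) * (L ^ d - (n j : ℝ) ^ d * (s j).L ^ d)) :=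
                    Finset.sum_le_sum fun i _ =>
                      mul_le_mul_of_nonneg_left (hY j i x) (hknn j i x)
                _ = _ := by
                    simp only [mul_add, Finset.sum_add_distrib]
                    rw [← Finset.sum_mul, h2, one_mul, h1]
                    rfl
        _ = _ := by
            rw [integral_add, integral_finsetSum]
            · have : ∀ b, ∫ x, (s j).Dr T (T (v j b) x) ∂M j = ∫ x, (s j).Dr T x ∂M j := fun b =>
                RDh.integral_inv (hinv j) _ (RDh.T_meas hT _) ((s j).Dr_meas hT)
              simp only [this]
              rw [Finset.sum_const, Finset.card_univ, nsmul_eq_mul, hcard, integral_const,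
                smul_eq_mul]
              ring
            · intro b _
              exact RDh.integrable_of_bdd (((s j).Dr_meas hT).comp (RDh.T_meas hT (v j b)))
                (Metric.diam (univ : Set X) * (s j).L ^ d) fun x => by
                rw [abs_of_nonneg ((s j).Dr_nonneg T _)]
                exact (s j).Dr_le T _
            · refine (integrable_finsetSum _ fun b _ => ?_)
              exact RDh.integrable_of_bdd (((s j).Dr_meas hT).comp (RDh.T_meas hT (v j b)))
                (Metric.diam (univ : Set X) * (s j).L ^ d) fun x => by
                rw [abs_of_nonneg ((s j).Dr_nonneg T _)]
                exact (s j).Dr_le T _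
            · exact integrable_const _
    · intro i _
      refine RDh.integrable_of_bdd ((hkm j i).mul
        (RDh.cst_cont hT (hYm j i).aestronglyMeasurable).measurable)
        (1 * (Metric.diam (univ : Set X) * L ^ d)) fun x => ?_
      rw [abs_mul, abs_of_nonneg (hknn j i x), abs_of_nonneg (RDh.cst_nonneg _ _ _ _)]
      exact mul_le_mul (hkle j i x) (RDh.cst_le T hL.le _ _) (RDh.cst_nonneg _ _ _ _) zero_le_one
  have main := RDh.RL_le hT hL (S := Σ j, (Fin d → Fin (n j)) → Fin (s j).m)
    (fun p => AEEqFun.mk (Y p.1 p.2) (hYm p.1 p.2).aestronglyMeasurable) (fun p => M p.1) μ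
    (fun p => hM p.1) (fun p x => ∏ b, K p.1 x b (p.2 b)) (fun p => hkm _ _)
    (fun p x => hknn _ _ _) (fun p x => hkle _ _ _)
    (fun p => (∏ b, (s p.1).q (p.2 b)) / N)
    (fun p => div_nonneg (Finset.prod_nonneg fun b _ => (s p.1).hq0 _) hN0.le)
    (by
      rw [Fintype.sum_sigma]
      simp only
      simp only [← Finset.sum_div]
      have : ∀ j, ∑ i : (Fin d → Fin (n j)) → Fin (s j).m, ∏ b, (s j).q (i b) = 1 := fun j =>
        RDh.sum_pi_one (fun _ => (s j).q) fun _ => (s j).hq1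
      simp only [this]
      rw [Finset.sum_const, Finset.card_univ, nsmul_eq_mul, mul_one, ← hN, div_self hN0.ne'])
    (fun p x h => hpac _ _ _ ((div_eq_zero_iff.1 h).resolve_right hN0.ne'))
    (by
      intro U hU
      rw [Fintype.sum_sigma]
      simp only
      have : ∀ j, ∑ i : (Fin d → Fin (n j)) → Fin (s j).m,
          ∫ x in U, ∏ b, K j x b (i b) ∂M j = (M j).real U := by
        intro j
        rw [← integral_finsetSum _ fun i _ => (hki j i).integrableOn]
        simp only [fun x => RDh.sum_pi_one (K j x) (hK1 j x)]
        simp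
      simp only [this]
      rw [← hsum, measureReal_def, Measure.finsetSum_apply, ENNReal.toReal_sum]
      · rfl
      · intro j _; exact measure_ne_top _ _)
    ε hdist'
  refine main.trans (le_of_eq ?_)
  congr 2
  rw [Fintype.sum_sigma]
  simp only
  have hterm : ∀ j x (i : (Fin d → Fin (n j)) → Fin (s j).m),
      (∏ b, K j x b (i b)) * Real.log ((∏ b, K j x b (i b)) / ((∏ b, (s j).q (i b)) / N)) =
      (∏ b, K j x b (i b)) * Real.log N +
      (∏ b, K j x b (i b)) * ∑ b, Real.log (K j x b (i b) / (s j).q (i b)) := by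
    intro j x i
    by_cases h : ∏ b, K j x b (i b) = 0
    · simp [h]
    · have hq : ∏ b, (s j).q (i b) ≠ 0 := fun h' => h (hpac j i x h')
      rw [← mul_add]
      congr 1
      rw [← Real.log_prod (s := Finset.univ), ← Real.log_mul hN0.ne', Finset.prod_div_distrib]
      · congr 1
        field_simp
      · rw [Finset.prod_div_distrib]
        exact div_ne_zero h hq
      · intro b _
        exact div_ne_zero (fun h' => h (Finset.prod_eq_zero (Finset.mem_univ b) h'))
          (fun h' => hq (Finset.prod_eq_zero (Finset.mem_univ b) h'))
  have hj : ∀ j, ∑ i : (Fin d → Fin (n j)) → Fin (s j).m, ∫ x, (∏ b, K j x b (i b)) *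
      Real.log ((∏ b, K j x b (i b)) / ((∏ b, (s j).q (i b)) / N)) ∂M j =
      (M j).real univ * Real.log N + (n j : ℝ) ^ d * ∫ x, (s j).Jr x ∂M j := by
    intro j
    rw [← integral_finsetSum]
    · have h1 : ∀ x, ∑ i : (Fin d → Fin (n j)) → Fin (s j).m, (∏ b, K j x b (i b)) *
          Real.log ((∏ b, K j x b (i b)) / ((∏ b, (s j).q (i b)) / N)) =
          Real.log N + ∑ b, (s j).Jr (T (v j b) x) := by
        intro x
        simp only [hterm, Finset.sum_add_distrib]
        rw [← Finset.sum_mul, RDh.sum_pi_one (K j x) (hK1 j x), one_mul,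
          RDh.sum_pi (K j x) (hK1 j x) (fun b i => Real.log (K j x b i / (s j).q i))]
        rfl
      simp only [h1]
      have hJi : ∀ b, Integrable (fun x => (s j).Jr (T (v j b) x)) (M j) := by
        intro b
        obtain ⟨C, hC⟩ := (s j).Jr_bdd
        exact RDh.integrable_of_bdd ((s j).Jr_meas.comp (RDh.T_meas hT _)) C fun x => hC _
      rw [integral_add (integrable_const _) (integrable_finsetSum _ fun b _ => hJi b),
        integral_finsetSum _ fun b _ => hJi b]
      have : ∀ b, ∫ x, (s j).Jr (T (v j b) x) ∂M j = ∫ x, (s j).Jr x ∂M j := fun b =>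
        RDh.integral_inv (hinv j) _ (RDh.T_meas hT _) ((s j).Jr_meas)
      simp only [this]
      rw [Finset.sum_const, Finset.card_univ, nsmul_eq_mul, hcard, integral_const, smul_eq_mul]
    · intro i _
      exact RDh.integrable_of_bdd (RDh.measurable_klog (hkm j i) _) _ fun x =>
        RDh.abs_klog (hknn j i x) (hkle j i x)
          fun h => hpac _ _ _ ((div_eq_zero_iff.1 h).resolve_right hN0.ne')
  simp only [hj, Finset.sum_add_distrib]
  congr 1
  rw [← Finset.sum_mul]
  have : ∑ j, (M j).real univ = 1 := by
    have h1 : μ.real univ = 1 := by simp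
    rw [← h1, ← hsum, measureReal_def, Measure.finsetSum_apply, ENNReal.toReal_sum]
    · rfl
    · intro j _; exact measure_ne_top _ _
  rw [this, one_mul]

lemma RDh.floor_tendsto (d : ℕ) {l : ℝ} (hl : 0 < l) :
    Tendsto (fun L : ℝ => ((⌊l⁻¹ * L⌋₊ : ℝ) * l / L) ^ d) atTop (𝓝 1) := by
  have h := (tendsto_nat_floor_mul_div_atTop (R := ℝ) (a := l⁻¹) (by positivity)).mul_const l
  rw [inv_mul_cancel₀ hl.ne'] at h
  have h2 := h.pow d
  rw [one_pow] at h2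
  refine h2.congr fun L => ?_
  rw [div_mul_eq_mul_div]

lemma RDh.RD_le_real {X : Type*} [MetricSpace X] [CompactSpace X] [MeasurableSpace X]
    [BorelSpace X] {d : ℕ} (hd : 0 < d) {T : (Fin d → ℝ) → X → X} (hT : IsContAction d T)
    {ι : Type} [Fintype ι] [Nonempty ι] (s : ι → RDh.Sch (X := X) d) (M : ι → Measure X)
    (μ : Measure X) [IsProbabilityMeasure μ] (hsum : ∑ j, M j = μ)
    (hinv : ∀ j, MeasInvariant d T (M j)) (ε : ℝ)
    (hdist : ∑ j, (∫ x, (s j).Dr T x ∂M j) / (s j).L ^ d < ε) :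
    RD d T μ ε ≤ ENNReal.ofReal ((∑ j, (∫ x, (s j).Jr x ∂M j) / (s j).L ^ d) / Real.log 2) := by
  set n : ℝ → ι → ℕ := fun L j => ⌊(s j).L⁻¹ * L⌋₊ with hn
  set r : ℝ → ι → ℝ := fun L j => ((n L j : ℝ) * (s j).L / L) ^ d with hr
  have hrt : ∀ j, Tendsto (fun L => r L j) atTop (𝓝 1) := fun j => RDh.floor_tendsto d (s j).hL
  have hre : ∀ L j, 0 < L → (n L j : ℝ) ^ d = r L j * L ^ d / (s j).L ^ d := by
    intro L j hL
    have := (s j).hL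
    simp only [hr]
    rw [div_pow, mul_pow]
    field_simp
  have hD : Tendsto (fun L : ℝ => ∑ j, (r L j * ((∫ x, (s j).Dr T x ∂M j) / (s j).L ^ d) +
      Metric.diam (univ : Set X) * (1 - r L j) * (M j).real univ)) atTop
      (𝓝 (∑ j, (1 * ((∫ x, (s j).Dr T x ∂M j) / (s j).L ^ d) +
      Metric.diam (univ : Set X) * (1 - 1) * (M j).real univ))) :=
    tendsto_finsetSum _ fun j _ => ((hrt j).mul_const _).add
      (((tendsto_const_nhds.sub (hrt j)).const_mul _).mul_const _)
  simp only [one_mul, sub_self, mul_zero, zero_mul, add_zero] at hD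
  have hJ : Tendsto (fun L : ℝ => (Real.log (Fintype.card ι) / L ^ d +
      ∑ j, r L j * ((∫ x, (s j).Jr x ∂M j) / (s j).L ^ d)) / Real.log 2) atTop
      (𝓝 ((0 + ∑ j, 1 * ((∫ x, (s j).Jr x ∂M j) / (s j).L ^ d)) / Real.log 2)) :=
    ((tendsto_const_nhds.div_atTop (tendsto_pow_atTop hd.ne')).add
      (tendsto_finsetSum _ fun j _ => (hrt j).mul_const _)).div_const _
  simp only [one_mul, zero_add] at hJ
  refine ge_of_tendsto ((ENNReal.continuous_ofReal.tendsto _).comp hJ) ?_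
  filter_upwards [hD.eventually (gt_mem_nhds hdist), eventually_gt_atTop 0] with L h1 hL
  have hLd : 0 < L ^ d := by positivity
  have key := RDh.RL_le_blocks hT s M μ hsum hinv hL (n L) (by
    intro j
    have hj := (s j).hL
    have : (n L j : ℝ) ≤ (s j).L⁻¹ * L := Nat.floor_le (by positivity)
    calc (n L j : ℝ) * (s j).L ≤ (s j).L⁻¹ * L * (s j).L := by gcongr
      _ = L := by field_simp) ε (by
    refine lt_of_eq_of_lt ?_ (mul_lt_mul_of_pos_right h1 hLd)
    rw [Finset.sum_mul]
    refine Finset.sum_congr rfl fun j _ => ?_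
    have hj := (s j).hL
    rw [hre L j hL]
    field_simp)
  calc RD d T μ ε ≤ RL d T μ L ε / ENNReal.ofReal (L ^ d) := iInf₂_le L hL
    _ ≤ _ := ENNReal.div_le_div_right key _
    _ = _ := by
      rw [← ENNReal.ofReal_div_of_pos hLd]
      simp only [Function.comp]
      congr 1
      rw [div_right_comm]
      congr 1
      rw [add_div, Finset.sum_div]
      congr 1
      refine Finset.sum_congr rfl fun j _ => ?_
      have hj := (s j).hL
      rw [hre L j hL]
      field_simp

/-- integrated information rate -/
noncomputable def RDh.Sch.JE {X : Type*} [MetricSpace X] [MeasurableSpace X] {d : ℕ}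
    (s : RDh.Sch (X := X) d) (M : Measure X) : ℝ≥0∞ :=
  ∫⁻ x, ENNReal.ofReal (s.Jr x / (s.L ^ d * Real.log 2)) ∂M

/-- integrated distortion -/
noncomputable def RDh.Sch.DE {X : Type*} [MetricSpace X] [MeasurableSpace X] {d : ℕ}
    (T : (Fin d → ℝ) → X → X) (s : RDh.Sch (X := X) d) (M : Measure X) : ℝ≥0∞ :=
  ∫⁻ x, ENNReal.ofReal (s.Dr T x / s.L ^ d) ∂M

lemma RDh.Sch.JE_eq {X : Type*} [MetricSpace X] [CompactSpace X] [MeasurableSpace X]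
    [BorelSpace X] {d : ℕ} (s : RDh.Sch (X := X) d) (M : Measure X) [IsFiniteMeasure M] :
    s.JE M = ENNReal.ofReal ((∫ x, s.Jr x ∂M) / (s.L ^ d * Real.log 2)) := by
  have := s.hL
  have h2 : 0 < Real.log 2 := Real.log_pos (by norm_num)
  unfold RDh.Sch.JE
  rw [← integral_div, ofReal_integral_eq_lintegral_ofReal ((s.Jr_int M).div_const _)]
  exact ae_of_all _ fun x => div_nonneg (s.Jr_nonneg x) (by positivity)

lemma RDh.Sch.DE_eq {X : Type*} [MetricSpace X] [CompactSpace X] [MeasurableSpace X]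
    [BorelSpace X] {d : ℕ} {T : (Fin d → ℝ) → X → X} (hT : IsContAction d T)
    (s : RDh.Sch (X := X) d) (M : Measure X) [IsFiniteMeasure M] :
    s.DE T M = ENNReal.ofReal ((∫ x, s.Dr T x ∂M) / s.L ^ d) := by
  have := s.hL
  unfold RDh.Sch.DE
  rw [← integral_div, ofReal_integral_eq_lintegral_ofReal ((s.Dr_int hT M).div_const _)]
  exact ae_of_all _ fun x => div_nonneg (s.Dr_nonneg T x) (by positivity)

lemma RDh.RD_le {X : Type*} [MetricSpace X] [CompactSpace X] [MeasurableSpace X]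
    [BorelSpace X] {d : ℕ} (hd : 0 < d) {T : (Fin d → ℝ) → X → X} (hT : IsContAction d T)
    {ι : Type} [Fintype ι] [Nonempty ι] (s : ι → RDh.Sch (X := X) d) (M : ι → Measure X)
    (μ : Measure X) [IsProbabilityMeasure μ] (hsum : ∑ j, M j = μ)
    (hinv : ∀ j, MeasInvariant d T (M j)) (ε : ℝ)
    (hdist : ∑ j, (s j).DE T (M j) < ENNReal.ofReal ε) :
    RD d T μ ε ≤ ∑ j, (s j).JE (M j) := by
  have hM : ∀ j, M j ≤ μ := by
    intro j
    rw [← hsum]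
    exact Finset.single_le_sum (f := M) (fun _ _ => Measure.zero_le _) (Finset.mem_univ j)
  have hfin : ∀ j, IsFiniteMeasure (M j) := fun j => isFiniteMeasure_of_le μ (hM j)
  have hDn : ∀ j, 0 ≤ (∫ x, (s j).Dr T x ∂M j) / (s j).L ^ d := fun j =>
    div_nonneg (integral_nonneg fun x => (s j).Dr_nonneg T x) (pow_nonneg (s j).hL.le _)
  have hJn : ∀ j, 0 ≤ (∫ x, (s j).Jr x ∂M j) / ((s j).L ^ d * Real.log 2) := fun j =>
    div_nonneg (integral_nonneg fun x => (s j).Jr_nonneg x)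
      (mul_nonneg (pow_nonneg (s j).hL.le _) (Real.log_nonneg (by norm_num)))
  simp only [fun j => (s j).DE_eq hT (M j)] at hdist
  simp only [fun j => (s j).JE_eq (M j)]
  rw [← ENNReal.ofReal_sum_of_nonneg fun j _ => hDn j] at hdist
  rw [← ENNReal.ofReal_sum_of_nonneg fun j _ => hJn j]
  refine (RDh.RD_le_real hd hT s M μ hsum hinv ε ?_).trans (le_of_eq ?_)
  · exact (ENNReal.ofReal_lt_ofReal_iff_of_nonneg (Finset.sum_nonneg fun j _ => hDn j)).1 hdist
  · congr 1
    rw [Finset.sum_div]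
    refine Finset.sum_congr rfl fun j _ => ?_
    rw [div_div]

lemma RDh.quantize {B ι : Type*} [MeasurableSpace B] [Fintype ι] (g : ι → B → ℝ)
    (hg : ∀ a, Measurable (g a)) (C : ℝ) (h0 : ∀ a y, 0 ≤ g a y) (hC : ∀ a y, g a y ≤ C)
    {η : ℝ} (hη : 0 < η) :
    ∃ (m : ℕ) (β : B → Fin m), Measurable β ∧
      ∀ y y', β y = β y' → ∀ a, |g a y - g a y'| ≤ η := by
  classical
  set N : ℕ := ⌊C / η⌋₊ + 1 with hN
  have hlt : ∀ a y, ⌊g a y / η⌋₊ < N := fun a y => Nat.lt_succ_of_le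
    (Nat.floor_le_floor (div_le_div_of_nonneg_right (hC a y) hη.le))
  set β0 : B → ι → Fin N := fun y a => ⟨⌊g a y / η⌋₊, hlt a y⟩ with hβ0
  have hm0 : Measurable β0 := by
    refine measurable_pi_iff.2 fun a => measurable_to_countable' fun i => ?_
    have : (fun y => β0 y a) ⁻¹' {i} = (fun y => ⌊g a y / η⌋₊) ⁻¹' {(i : ℕ)} := by
      ext y; simp [hβ0, Fin.ext_iff]
    rw [this]
    exact (Nat.measurable_floor.comp ((hg a).div_const η)) (measurableSet_singleton _)
  refine ⟨_, fun y => Fintype.equivFin (ι → Fin N) (β0 y),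
    (measurable_from_top (f := Fintype.equivFin (ι → Fin N))).comp
      (hm0.mono le_rfl ?_), ?_⟩
  · intro s _; exact (Set.toFinite s).measurableSet
  · intro y y' h a
    have h1 := congrFun ((Fintype.equivFin _).injective h) a
    simp only [hβ0, Fin.mk.injEq] at h1
    have e1 := Nat.floor_le (div_nonneg (h0 a y) hη.le)
    have e2 := Nat.lt_floor_add_one (g a y / η)
    have e3 := Nat.floor_le (div_nonneg (h0 a y') hη.le)
    have e4 := Nat.lt_floor_add_one (g a y' / η)
    rw [h1] at e1 e2
    rw [le_div_iff₀ hη] at e1 e3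
    rw [div_lt_iff₀ hη] at e2 e4
    rw [abs_le]
    constructor <;> nlinarith

lemma RDh.exists_partition (X : Type*) [MetricSpace X] [CompactSpace X] [MeasurableSpace X]
    [BorelSpace X] {r : ℝ} (hr : 0 < r) :
    ∃ (m : ℕ) (α : X → Fin m), Measurable α ∧ ∀ x x', α x = α x' → dist x x' < r := by
  obtain ⟨t, -, htf, ht⟩ := finite_cover_balls_of_compact (isCompact_univ (X := X))
    (show 0 < r / 4 by positivity)
  have : Fintype t := htf.fintype
  obtain ⟨m, α, hα, h⟩ := RDh.quantize (fun (a : t) (x : X) => dist (a : X) x)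
    (fun a => (continuous_const.dist continuous_id).measurable) (Metric.diam (univ : Set X))
    (fun _ _ => dist_nonneg) (fun _ _ => RDh.dist_le _ _) (show 0 < r / 4 by positivity)
  refine ⟨m, α, hα, fun x x' hxx => ?_⟩
  obtain ⟨c, hc, hxc⟩ := mem_iUnion₂.1 (ht (mem_univ x))
  have h1 := (abs_le.1 (h x x' hxx ⟨c, hc⟩)).1
  have h2 : dist x c < r / 4 := hxc
  simp only at h1
  have h3 := dist_triangle x c x'
  rw [dist_comm c x] at h1
  linarith

lemma RDh.cst_meas_y {X : Type*} [MetricSpace X] [CompactSpace X] {d : ℕ}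
    {T : (Fin d → ℝ) → X → X} (hT : IsContAction d T) (L : ℝ) (x : X) :
    Measurable fun y : L1Maps d L X => RDh.cst T L x y := by
  have : (fun y : L1Maps d L X => RDh.cst T L x y) = fun y =>
      L1dist (AEEqFun.mk (fun u => T u x) (RDh.orb_meas hT x).aestronglyMeasurable) y := by
    ext y
    unfold RDh.cst L1dist
    refine integral_congr_ae ?_
    filter_upwards [AEEqFun.coeFn_mk (fun u => T u x)
      (RDh.orb_meas hT x).aestronglyMeasurable (μ := boxMeasure d L)] with u hu
    rw [hu]
  rw [this]
  refine measurable_of_Iio fun r => MeasurableSpace.measurableSet_generateFrom ⟨_, r, rfl⟩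

lemma RDh.cst_unif {X : Type*} [MetricSpace X] [CompactSpace X] {d : ℕ}
    {T : (Fin d → ℝ) → X → X} (hT : IsContAction d T) (L : ℝ) {η : ℝ} (hη : 0 < η) :
    ∃ δ > 0, ∀ x x', dist x x' < δ → ∀ y : (Fin d → ℝ) → X,
      AEStronglyMeasurable y (boxMeasure d L) →
      |RDh.cst T L x y - RDh.cst T L x' y| ≤ η := by
  have hintg : ∀ x x', Integrable (fun u => dist (T u x) (T u x')) (boxMeasure d L) :=
    fun x x' => RDh.cst_integrable hT x (RDh.orb_meas hT x').aestronglyMeasurable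
  have hc : Continuous fun p : X × X => ∫ u, dist (T u p.1) (T u p.2) ∂boxMeasure d L := by
    refine continuous_of_dominated (bound := fun _ => Metric.diam (univ : Set X))
      (fun p => (hintg p.1 p.2).aestronglyMeasurable) (fun p => ae_of_all _ fun u => ?_)
      (integrable_const _) (ae_of_all _ fun u => ?_)
    · rw [Real.norm_of_nonneg dist_nonneg]
      exact RDh.dist_le _ _
    · have h := fun v => hT.1.comp (by fun_prop : Continuous fun x : X => ((v : Fin d → ℝ), x))
      exact ((h u).comp continuous_fst).dist ((h u).comp continuous_snd)
  obtain ⟨δ, hδ, h⟩ := Metric.uniformContinuous_iff.1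
    (CompactSpace.uniformContinuous_of_continuous hc) η hη
  refine ⟨δ, hδ, fun x x' hxx y hy => ?_⟩
  have h1 := h (a := (x, x')) (b := (x', x')) (by simpa [Prod.dist_eq, hδ] using hxx)
  simp only [dist_self, integral_zero, dist_zero_right] at h1
  rw [Real.norm_of_nonneg (integral_nonneg fun _ => dist_nonneg)] at h1
  unfold RDh.cst
  rw [← integral_sub (RDh.cst_integrable hT x hy) (RDh.cst_integrable hT x' hy)]
  refine (abs_integral_le_integral_abs).trans (le_trans ?_ h1.le)
  refine integral_mono_of_nonneg (ae_of_all _ fun _ => abs_nonneg _) (hintg x x')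
    (ae_of_all _ fun u => ?_)
  exact abs_dist_sub_le _ _ _

lemma RDh.extract {X : Type*} [MetricSpace X] [CompactSpace X] [MeasurableSpace X]
    [BorelSpace X] {d : ℕ} {T : (Fin d → ℝ) → X → X} (hT : IsContAction d T)
    (p : ℕ → ℕ) (α : ∀ n, X → Fin (p n)) (hα : ∀ n, Measurable (α n))
    (hcell : ∀ n x x', α n x = α n x' → dist x x' < 1 / ((n : ℝ) + 1))
    (ν : Measure X) [IsProbabilityMeasure ν] (e : ℝ) (r : ℝ≥0∞) (h : RD d T ν e < r) :
    ∃ (n : ℕ) (s : RDh.Sch (X := X) d) (j c : Fin (p n) → ℝ),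
      (∀ x, s.Jr x / (s.L ^ d * Real.log 2) = j (α n x)) ∧
      (∀ x, s.Dr T x / s.L ^ d ≤ c (α n x)) ∧
      ENNReal.ofReal (∑ a, ν.real (α n ⁻¹' {a}) * j a) < r ∧
      ∑ a, ν.real (α n ⁻¹' {a}) * c a < e := by
  classical
  unfold RD at h
  obtain ⟨L, h⟩ := iInf_lt_iff.1 h
  obtain ⟨hL, h⟩ := iInf_lt_iff.1 h
  have hLd : 0 < L ^ d := by positivity
  rw [ENNReal.div_lt_iff (Or.inl (by simpa using hLd)) (Or.inl ENNReal.ofReal_ne_top)] at h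
  simp only [RL, iInf_lt_iff] at h
  obtain ⟨Ω, mΩ, P, hP, Xv, Yv, hX, hY, hmap, hdist, h⟩ := h
  have hne : Nonempty X := nonempty_of_isProbabilityMeasure ν
  have hneΩ : Nonempty Ω := nonempty_of_isProbabilityMeasure P
  have hneY : Nonempty (L1Maps d L X) := ⟨Yv hneΩ.some⟩
  set g : Ω → ℝ := fun ω => (L ^ d)⁻¹ * RDh.cst T L (Xv ω) (Yv ω) with hg
  have hdist : ∫ ω, g ω ∂P < e := hdist
  set η : ℝ := (e - ∫ ω, g ω ∂P) / 4 with hη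
  have hη0 : 0 < η := by rw [hη]; linarith
  obtain ⟨δ, hδ, hunif⟩ := RDh.cst_unif hT L (η := η * L ^ d) (by positivity)
  obtain ⟨n, hn⟩ := exists_nat_one_div_lt hδ
  set A := α n with hA
  set xr : Fin (p n) → X := Function.invFun A with hxr
  have hAr : ∀ x, A (xr (A x)) = A x := fun x => Function.invFun_eq ⟨x, rfl⟩
  have hclose : ∀ x (y : (Fin d → ℝ) → X), AEStronglyMeasurable y (boxMeasure d L) →
      |RDh.cst T L x y - RDh.cst T L (xr (A x)) y| ≤ η * L ^ d := fun x y hy =>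
    hunif _ _ ((hcell n _ _ (hAr x).symm).trans hn) y hy
  obtain ⟨m, β, hβ, hβc⟩ := RDh.quantize
    (fun (a : Fin (p n)) (y : L1Maps d L X) => RDh.cst T L (xr a) y)
    (fun a => RDh.cst_meas_y hT L _) (Metric.diam (univ : Set X) * L ^ d)
    (fun _ _ => RDh.cst_nonneg _ _ _ _) (fun _ _ => RDh.cst_le T hL.le _ _)
    (show 0 < η * L ^ d by positivity)
  set yr : Fin m → L1Maps d L X := Function.invFun β with hyr
  have hBr : ∀ y, β (yr (β y)) = β y := fun y => Function.invFun_eq ⟨y, rfl⟩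
  set F : Ω → Fin (p n) := fun ω => A (Xv ω) with hF
  set G : Ω → Fin m := fun ω => β (Yv ω) with hG
  have hFm : Measurable F := (hα n).comp hX
  have hGm : Measurable G := hβ.comp hY
  have hνa : ∀ a, ν.real (A ⁻¹' {a}) = P.real (F ⁻¹' {a}) := by
    intro a
    rw [← hmap, measureReal_def, Measure.map_apply hX ((hα n) (measurableSet_singleton a))]
    rfl
  set pa : Fin (p n) → ℝ := fun a => P.real (F ⁻¹' {a}) with hpa
  set q : Fin m → ℝ := fun i => P.real (G ⁻¹' {i}) with hq
  set pp : Fin (p n) → Fin m → ℝ := fun a i => P.real (F ⁻¹' {a} ∩ G ⁻¹' {i}) with hpp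
  have hppa : ∀ a i, pp a i ≤ pa a := fun a i => measureReal_mono inter_subset_left
  have hppq : ∀ a i, pp a i ≤ q i := fun a i => measureReal_mono inter_subset_right
  have hpp0 : ∀ a i, 0 ≤ pp a i := fun a i => measureReal_nonneg
  have hq0 : ∀ i, 0 ≤ q i := fun i => measureReal_nonneg
  have hsumG : ∀ S : Set Ω, MeasurableSet S → ∑ i, P.real (S ∩ G ⁻¹' {i}) = P.real S := by
    intro S hS
    rw [← measureReal_biUnion_finset]
    · congr 1; ext ω; simp
    · intro i _ i' _ hii
      refine Set.disjoint_left.2 fun ω h1 h2 => hii ?_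
      rw [← show G ω = i from h1.2, ← show G ω = i' from h2.2]
    · intro i _; exact hS.inter (hGm (measurableSet_singleton i))
  have hq1 : ∑ i, q i = 1 := by
    have := hsumG univ MeasurableSet.univ
    simpa using this
  have hpp1 : ∀ a, ∑ i, pp a i = pa a := fun a => hsumG _ (hFm (measurableSet_singleton a))
  set k : Fin (p n) → Fin m → ℝ := fun a i => if pa a = 0 then q i else pp a i / pa a with hk
  have hk0 : ∀ a i, 0 ≤ k a i := by
    intro a i
    simp only [hk]
    split_ifs
    · exact hq0 i
    · exact div_nonneg (hpp0 a i) measureReal_nonneg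
  have hk1 : ∀ a, ∑ i, k a i = 1 := by
    intro a
    simp only [hk]
    split_ifs with h0
    · exact hq1
    · rw [← Finset.sum_div, hpp1, div_self h0]
  have hac : ∀ a i, q i = 0 → k a i = 0 := by
    intro a i h0
    simp only [hk]
    split_ifs
    · exact h0
    · rw [le_antisymm ((hppq a i).trans h0.le) (hpp0 a i), zero_div]
  have hpk : ∀ a i, pa a * k a i = pp a i := by
    intro a i
    simp only [hk]
    split_ifs with h0
    · rw [h0, zero_mul]; exact (le_antisymm ((hppa a i).trans h0.le) (hpp0 a i)).symm
    · rw [mul_div_cancel₀ _ h0]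
  let s : RDh.Sch (X := X) d :=
    { L := L, hL := hL, m := m, k := fun x i => k (A x) i
      hkm := fun i => (measurable_from_top (f := fun a => k a i)).comp ((hα n).mono le_rfl
        (fun s _ => (Set.toFinite s).measurableSet))
      hk0 := fun x i => hk0 _ _, hk1 := fun x => hk1 _, q := q, hq0 := hq0, hq1 := hq1
      hac := fun x i => hac _ _, y := fun i => yr i, hy := fun i => (yr i).measurable }
  refine ⟨n, s, fun a => (∑ i, k a i * Real.log (k a i / q i)) / (L ^ d * Real.log 2),
    fun a => ∑ i, k a i * (RDh.cst T L (xr a) (yr i) / L ^ d + η), fun x => rfl, ?_, ?_, ?_⟩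
  · intro x
    change (∑ i, k (A x) i * RDh.cst T L x (yr i)) / L ^ d ≤ _
    rw [Finset.sum_div]
    refine Finset.sum_le_sum fun i _ => ?_
    rw [mul_div_assoc]
    refine mul_le_mul_of_nonneg_left ?_ (hk0 _ _)
    rw [div_add' _ _ _ hLd.ne']
    refine div_le_div_of_nonneg_right ?_ hLd.le
    have := (abs_le.1 (hclose x (yr i) (yr i).aestronglyMeasurable)).2
    linarith
  · have hent := RDh.ent_eq P F G hFm hGm
    have e1 : ∑ a, ν.real (A ⁻¹' {a}) * ((∑ i, k a i * Real.log (k a i / q i)) /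
        (L ^ d * Real.log 2)) = (shannonEntropy P F + shannonEntropy P G -
          shannonEntropy P (fun ω => (F ω, G ω))) / L ^ d := by
      rw [hent, div_div, mul_comm (Real.log 2), Finset.sum_div]
      refine Finset.sum_congr rfl fun a _ => ?_
      rw [hνa, ← mul_div_assoc, Finset.mul_sum]
      congr 1
      refine Finset.sum_congr rfl fun i _ => ?_
      rw [← mul_assoc]
      change pa a * k a i * _ = pp a i * (Real.log (pp a i) - Real.log (pa a) - Real.log (q i))
      rw [hpk]
      by_cases h0 : pp a i = 0
      · rw [h0]; simp
      · have hpos : 0 < pp a i := (hpp0 a i).lt_of_ne (Ne.symm h0)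
        have h1 : pa a ≠ 0 := (hpos.trans_le (hppa a i)).ne'
        have h2 : q i ≠ 0 := (hpos.trans_le (hppq a i)).ne'
        congr 1
        simp only [hk, h1, if_false]
        rw [Real.log_div (div_ne_zero h0 h1) h2, Real.log_div h0 h1]
    rw [e1, ENNReal.ofReal_div_of_pos hLd, ENNReal.div_lt_iff (Or.inl (by simpa using hLd))
      (Or.inl ENNReal.ofReal_ne_top)]
    refine lt_of_le_of_lt ?_ h
    unfold mutualInfo
    exact le_iSup_of_le (p n) <| le_iSup_of_le m <| le_iSup_of_le A <| le_iSup_of_le (hα n) <|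
      le_iSup_of_le β <| le_iSup_of_le hβ le_rfl
  · have hgm : Measurable g := by
      have h1 : Measurable (Function.uncurry fun (x : X) (y : L1Maps d L X) => RDh.cst T L x y) :=
        measurable_uncurry_of_continuous_of_measurable
          (fun y => RDh.cst_cont hT y.aestronglyMeasurable) (fun x => RDh.cst_meas_y hT L x)
      exact (h1.comp (hX.prodMk hY)).const_mul _
    have hgi : Integrable g P := by
      refine RDh.integrable_of_bdd hgm ((L ^ d)⁻¹ * (Metric.diam (univ : Set X) * L ^ d))
        fun ω => ?_
      rw [abs_of_nonneg (mul_nonneg (by positivity) (RDh.cst_nonneg _ _ _ _))]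
      exact mul_le_mul_of_nonneg_left (RDh.cst_le T hL.le _ _) (by positivity)
    set H : Fin (p n) × Fin m → ℝ := fun z => RDh.cst T L (xr z.1) (yr z.2) / L ^ d + η with hH
    have hFG : Measurable fun ω => (F ω, G ω) := hFm.prodMk hGm
    have hHm : Measurable H := measurable_of_finite H
    have hintg : ∫ ω, H (F ω, G ω) ∂P = ∑ a, ν.real (A ⁻¹' {a}) *
        ∑ i, k a i * (RDh.cst T L (xr a) (yr i) / L ^ d + η) := by
      have hpm : IsProbabilityMeasure (P.map fun ω => (F ω, G ω)) :=
        Measure.isProbabilityMeasure_map hFG.aemeasurable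
      rw [← integral_map (f := H) hFG.aemeasurable hHm.aestronglyMeasurable,
        integral_fintype Integrable.of_finite, Fintype.sum_prod_type]
      refine Finset.sum_congr rfl fun a _ => ?_
      rw [hνa, Finset.mul_sum]
      refine Finset.sum_congr rfl fun i _ => ?_
      rw [← mul_assoc]
      change _ = pa a * k a i * _
      rw [hpk, smul_eq_mul, measureReal_def, Measure.map_apply hFG (measurableSet_singleton _)]
      congr 3
      ext ω
      simp [Prod.ext_iff]
    rw [← hintg]
    have hle : ∫ ω, H (F ω, G ω) ∂P ≤ ∫ ω, (g ω + 3 * η) ∂P := by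
      refine integral_mono_of_nonneg (ae_of_all _ fun ω => ?_) (hgi.add (integrable_const _))
        (ae_of_all _ fun ω => ?_)
      · exact add_nonneg (div_nonneg (RDh.cst_nonneg _ _ _ _) hLd.le) hη0.le
      · simp only [hH, hg]
        have h1 := (abs_le.1 (hβc _ _ (hBr (Yv ω)) (F ω))).2
        have h2 := (abs_le.1 (hclose (Xv ω) (Yv ω) (Yv ω).aestronglyMeasurable)).1
        have h3 : RDh.cst T L (xr (F ω)) (yr (G ω)) / L ^ d ≤
            (RDh.cst T L (Xv ω) (Yv ω) + 2 * (η * L ^ d)) / L ^ d := by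
          refine div_le_div_of_nonneg_right ?_ hLd.le
          linarith
        have h4 : (RDh.cst T L (Xv ω) (Yv ω) + 2 * (η * L ^ d)) / L ^ d =
          (L ^ d)⁻¹ * RDh.cst T L (Xv ω) (Yv ω) + 2 * η := by field_simp
        linarith
    refine hle.trans_lt ?_
    rw [integral_add hgi (integrable_const _)]
    simp only [integral_const, probReal_univ, smul_eq_mul, one_mul]
    rw [hη]; linarith

/-- the constant scheme -/
noncomputable def RDh.constSch {X : Type*} [MetricSpace X] [MeasurableSpace X] (d : ℕ) (x0 : X) :
    RDh.Sch (X := X) d where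
  L := 1
  hL := one_pos
  m := 1
  k := fun _ _ => 1
  hkm := fun _ => measurable_const
  hk0 := fun _ _ => zero_le_one
  hk1 := fun _ => by simp
  q := fun _ => 1
  hq0 := fun _ => zero_le_one
  hq1 := by simp
  hac := fun _ _ h => h
  y := fun _ _ => x0
  hy := fun _ => measurable_const

lemma RDh.constSch_JE {X : Type*} [MetricSpace X] [MeasurableSpace X] (d : ℕ) (x0 : X)
    (M : Measure X) : (RDh.constSch d x0).JE M = 0 := by
  unfold RDh.Sch.JE RDh.Sch.Jr RDh.constSch
  simp

lemma RDh.Sch.DE_le {X : Type*} [MetricSpace X] [CompactSpace X] [MeasurableSpace X]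
    [BorelSpace X] {d : ℕ} (T : (Fin d → ℝ) → X → X) (s : RDh.Sch (X := X) d) (M : Measure X) :
    s.DE T M ≤ ENNReal.ofReal (Metric.diam (univ : Set X)) * M univ := by
  unfold RDh.Sch.DE
  rw [← lintegral_const]
  refine lintegral_mono fun x => ENNReal.ofReal_le_ofReal ?_
  rw [div_le_iff₀ (pow_pos s.hL d)]
  exact s.Dr_le T x

lemma RDh.integral_cell {X : Type*} [MeasurableSpace X] {n : ℕ} {A : X → Fin n}
    (hA : Measurable A) (j : Fin n → ℝ) (ν : Measure X) [IsProbabilityMeasure ν] :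
    ∫ x, j (A x) ∂ν = ∑ a, ν.real (A ⁻¹' {a}) * j a := by
  have hpm : IsProbabilityMeasure (ν.map A) := Measure.isProbabilityMeasure_map hA.aemeasurable
  rw [← integral_map (f := j) hA.aemeasurable (measurable_of_finite j).aestronglyMeasurable,
    integral_fintype Integrable.of_finite]
  refine Finset.sum_congr rfl fun a _ => ?_
  rw [smul_eq_mul, measureReal_def, Measure.map_apply hA (measurableSet_singleton _)]
  rfl

lemma RDh.countable_family {X : Type*} [MetricSpace X] [CompactSpace X] [MeasurableSpace X]
    [BorelSpace X] [Nonempty X] {d : ℕ} {T : (Fin d → ℝ) → X → X} (hT : IsContAction d T) :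
    ∃ s : ℕ → RDh.Sch (X := X) d, ∀ (ν : Measure X) [IsProbabilityMeasure ν] (e : ℝ) (r : ℝ≥0∞),
      RD d T ν e < r → ∃ t, (s t).JE ν < r ∧ (s t).DE T ν < ENNReal.ofReal e := by
  have hpart := fun n : ℕ => RDh.exists_partition X (r := 1 / ((n : ℝ) + 1)) (by positivity)
  choose p α hα hcell using hpart
  let I : ℕ → Type _ := fun n => {z : RDh.Sch (X := X) d × (Fin (p n) → ℝ) × (Fin (p n) → ℝ) //
    (∀ x, z.1.Jr x / (z.1.L ^ d * Real.log 2) = z.2.1 (α n x)) ∧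
      (∀ x, z.1.Dr T x / z.1.L ^ d ≤ z.2.2 (α n x))}
  let U : ∀ n, I n → Set ((Fin (p n) → ℝ) × ℝ × ℝ≥0∞) := fun n z =>
    {w | ENNReal.ofReal (∑ a, w.1 a * z.1.2.1 a) < w.2.2} ∩ {w | ∑ a, w.1 a * z.1.2.2 a < w.2.1}
  have hU : ∀ n z, IsOpen (U n z) := by
    intro n z
    refine IsOpen.inter (isOpen_lt ?_ ?_) (isOpen_lt ?_ ?_)
    · exact ENNReal.continuous_ofReal.comp (by fun_prop)
    · fun_prop
    · fun_prop
    · fun_prop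
  have hcov := fun n => TopologicalSpace.isOpen_iUnion_countable (U n) (hU n)
  choose S hSc hS using hcov
  let R : Set (RDh.Sch (X := X) d) :=
    insert (RDh.constSch d (Classical.arbitrary X)) (⋃ n, (fun z : I n => z.1.1) '' S n)
  have hRc : R.Countable := (countable_iUnion fun n => (hSc n).image _).insert _
  obtain ⟨s, hs⟩ := hRc.exists_eq_range (insert_nonempty _ _)
  refine ⟨s, fun ν _ e r h => ?_⟩
  obtain ⟨n, s0, j, c, hj, hc, h1, h2⟩ := RDh.extract hT p α hα hcell ν e r h
  have hmem : ((fun a => ν.real (α n ⁻¹' {a}), e, r) : (Fin (p n) → ℝ) × ℝ × ℝ≥0∞) ∈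
      ⋃ z, U n z := mem_iUnion.2 ⟨⟨(s0, j, c), hj, hc⟩, h1, h2⟩
  rw [← hS n] at hmem
  obtain ⟨z, hz, hzU⟩ := mem_iUnion₂.1 hmem
  have hzR : z.1.1 ∈ R := Or.inr (mem_iUnion.2 ⟨n, z, hz, rfl⟩)
  rw [hs] at hzR
  obtain ⟨t, ht⟩ := hzR
  refine ⟨t, ?_, ?_⟩
  · rw [ht, RDh.Sch.JE_eq, ← integral_div]
    simp only [z.2.1]
    rw [RDh.integral_cell (hα n)]
    exact hzU.1
  · have hnn : 0 ≤ (∫ x, z.1.1.Dr T x ∂ν) / z.1.1.L ^ d :=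
      div_nonneg (integral_nonneg fun x => z.1.1.Dr_nonneg T x) (pow_nonneg z.1.1.hL.le _)
    rw [ht, RDh.Sch.DE_eq hT, ENNReal.ofReal_lt_ofReal_iff_of_nonneg hnn, ← integral_div]
    refine lt_of_le_of_lt ?_ hzU.2
    rw [← RDh.integral_cell (hα n)]
    refine integral_mono_of_nonneg (ae_of_all _ fun x => div_nonneg (z.1.1.Dr_nonneg T x)
      (pow_nonneg z.1.1.hL.le _)) ?_ (ae_of_all _ z.2.2)
    exact RDh.integrable_of_bdd ((measurable_of_finite z.1.2.2).comp (hα n))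
      (∑ a, |z.1.2.2 a|) fun x =>
        Finset.single_le_sum (f := fun a => |z.1.2.2 a|) (fun _ _ => abs_nonneg _)
          (Finset.mem_univ _)

lemma RDh.RD_le_single {X : Type*} [MetricSpace X] [CompactSpace X] [MeasurableSpace X]
    [BorelSpace X] {d : ℕ} (hd : 0 < d) {T : (Fin d → ℝ) → X → X} (hT : IsContAction d T)
    (s : RDh.Sch (X := X) d) (ν : Measure X) [IsProbabilityMeasure ν]
    (hinv : MeasInvariant d T ν) (e : ℝ) (h : s.DE T ν < ENNReal.ofReal e) :
    RD d T ν e ≤ s.JE ν := by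
  have := RDh.RD_le hd hT (fun _ : Unit => s) (fun _ => ν) ν (by simp) (fun _ => hinv) e
    (by simpa using h)
  simpa using this

lemma RDh.meas_coe {X : Type*} [MetricSpace X] [MeasurableSpace X] {d : ℕ}
    {T : (Fin d → ℝ) → X → X} : Measurable fun ν : InvM X d T => (ν.1 : Measure X) :=
  measurable_subtype_coe.comp measurable_subtype_coe

lemma RDh.Sch.JE_meas {X : Type*} [MetricSpace X] [CompactSpace X] [MeasurableSpace X]
    [BorelSpace X] {d : ℕ} (s : RDh.Sch (X := X) d) : Measurable s.JE :=
  Measure.measurable_lintegral ((s.Jr_meas.div_const _).ennreal_ofReal)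

lemma RDh.Sch.DE_meas {X : Type*} [MetricSpace X] [CompactSpace X] [MeasurableSpace X]
    [BorelSpace X] {d : ℕ} {T : (Fin d → ℝ) → X → X} (hT : IsContAction d T)
    (s : RDh.Sch (X := X) d) : Measurable (s.DE T) :=
  Measure.measurable_lintegral (((s.Dr_meas hT).div_const _).ennreal_ofReal)

lemma RDh.Sch.JE_bind {X : Type*} [MetricSpace X] [CompactSpace X] [MeasurableSpace X]
    [BorelSpace X] {d : ℕ} {T : (Fin d → ℝ) → X → X} (s : RDh.Sch (X := X) d)
    (m : Measure (InvM X d T)) :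
    s.JE (m.bind fun ν => (ν.1 : Measure X)) = ∫⁻ ν, s.JE (ν.1 : Measure X) ∂m :=
  Measure.lintegral_bind RDh.meas_coe.aemeasurable
    ((s.Jr_meas.div_const _).ennreal_ofReal).aemeasurable

lemma RDh.Sch.DE_bind {X : Type*} [MetricSpace X] [CompactSpace X] [MeasurableSpace X]
    [BorelSpace X] {d : ℕ} {T : (Fin d → ℝ) → X → X} (hT : IsContAction d T)
    (s : RDh.Sch (X := X) d) (m : Measure (InvM X d T)) :
    s.DE T (m.bind fun ν => (ν.1 : Measure X)) = ∫⁻ ν, s.DE T (ν.1 : Measure X) ∂m :=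
  Measure.lintegral_bind RDh.meas_coe.aemeasurable
    (((s.Dr_meas hT).div_const _).ennreal_ofReal).aemeasurable

lemma RDh.bind_inv {X : Type*} [MetricSpace X] [MeasurableSpace X]
    [BorelSpace X] {d : ℕ} {T : (Fin d → ℝ) → X → X} (hT : IsContAction d T)
    (m : Measure (InvM X d T)) : MeasInvariant d T (m.bind fun ν => (ν.1 : Measure X)) := by
  intro u
  have hTm := RDh.T_meas hT u
  ext A hA
  rw [Measure.map_apply hTm hA, Measure.bind_apply hA RDh.meas_coe.aemeasurable,
    Measure.bind_apply (hTm hA) RDh.meas_coe.aemeasurable]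
  refine lintegral_congr fun ν => ?_
  rw [← Measure.map_apply hTm hA, ν.2 u]

lemma RDh.lower {X : Type*} [MetricSpace X] [CompactSpace X] [MeasurableSpace X] [BorelSpace X]
    (d : ℕ) (hd : 0 < d) (T : (Fin d → ℝ) → X → X) (hT : IsContAction d T)
    (lam : Measure (InvM X d T)) [IsProbabilityMeasure lam]
    (μ : Measure X) [IsProbabilityMeasure μ]
    (hμ : μ = lam.bind fun ν => (ν.1 : Measure X))
    (ε : ℝ) (r : ℝ≥0∞) (h : RD d T μ ε < r) :
    ∃ f : InvM X d T → ℝ, Measurable f ∧ (∀ ν, 0 < f ν) ∧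
        (∫⁻ ν, ENNReal.ofReal (f ν) ∂lam) ≤ ENNReal.ofReal ε ∧
        ∫⁻ ν, RD d T (ν.1 : Measure X) (f ν) ∂lam < r := by
  have hne : Nonempty X := nonempty_of_isProbabilityMeasure μ
  obtain ⟨S, hS⟩ := RDh.countable_family (X := X) hT
  obtain ⟨t, hJ, hD⟩ := hS μ ε r h
  set s := S t
  have hprob : ∀ ν : InvM X d T, IsProbabilityMeasure (ν.1 : Measure X) := fun ν => inferInstance
  have hfin : ∀ ν : InvM X d T, s.DE T (ν.1 : Measure X) ≠ ⊤ := fun ν => by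
    rw [s.DE_eq hT]; exact ENNReal.ofReal_ne_top
  have hfinμ : s.DE T μ ≠ ⊤ := hD.ne_top
  have hgap : 0 < ε - (s.DE T μ).toReal := by
    rw [sub_pos]; exact ENNReal.toReal_lt_of_lt_ofReal hD
  have hof : ∀ ν : InvM X d T, ENNReal.ofReal ((s.DE T (ν.1 : Measure X)).toReal +
      (ε - (s.DE T μ).toReal)) = s.DE T (ν.1 : Measure X) +
        ENNReal.ofReal (ε - (s.DE T μ).toReal) := fun ν => by
    rw [ENNReal.ofReal_add ENNReal.toReal_nonneg hgap.le, ENNReal.ofReal_toReal (hfin ν)]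
  have hDm : Measurable fun ν : InvM X d T => s.DE T (ν.1 : Measure X) :=
    (s.DE_meas hT).comp RDh.meas_coe
  refine ⟨fun ν => (s.DE T (ν.1 : Measure X)).toReal + (ε - (s.DE T μ).toReal),
    hDm.ennreal_toReal.add_const _, fun ν => add_pos_of_nonneg_of_pos ENNReal.toReal_nonneg hgap,
    ?_, ?_⟩
  · simp only [hof]
    rw [lintegral_add_left hDm, lintegral_const, measure_univ, mul_one, ← s.DE_bind hT, ← hμ]
    rw [ENNReal.ofReal_sub _ ENNReal.toReal_nonneg, ENNReal.ofReal_toReal hfinμ,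
      add_tsub_cancel_of_le hD.le]
  · refine lt_of_le_of_lt ?_ hJ
    conv_rhs => rw [hμ]
    rw [s.JE_bind]
    refine lintegral_mono fun ν => ?_
    refine RDh.RD_le_single hd hT s _ ν.2 _ ?_
    rw [hof]
    exact ENNReal.lt_add_right (hfin ν) (by simpa using hgap)

lemma RDh.RD_meas {X : Type*} [MetricSpace X] [CompactSpace X] [MeasurableSpace X] [BorelSpace X]
    {d : ℕ} (hd : 0 < d) {T : (Fin d → ℝ) → X → X} (hT : IsContAction d T)
    (S : ℕ → RDh.Sch (X := X) d)
    (hS : ∀ (ν : Measure X) [IsProbabilityMeasure ν] (e : ℝ) (r : ℝ≥0∞),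
      RD d T ν e < r → ∃ t, (S t).JE ν < r ∧ (S t).DE T ν < ENNReal.ofReal e)
    (f : InvM X d T → ℝ) (hf : Measurable f) :
    Measurable fun ν : InvM X d T => RD d T (ν.1 : Measure X) (f ν) := by
  refine measurable_of_Iio fun r => ?_
  have : (fun ν : InvM X d T => RD d T (ν.1 : Measure X) (f ν)) ⁻¹' Iio r =
      ⋃ t, ({ν : InvM X d T | (S t).JE (ν.1 : Measure X) < r} ∩
        {ν : InvM X d T | (S t).DE T (ν.1 : Measure X) < ENNReal.ofReal (f ν)}) := by
    ext ν
    simp only [mem_preimage, mem_Iio, mem_iUnion, mem_inter_iff, mem_setOf_eq]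
    constructor
    · intro h; exact hS _ _ _ h
    · rintro ⟨t, h1, h2⟩
      exact (RDh.RD_le_single hd hT (S t) _ ν.2 _ h2).trans_lt h1
  rw [this]
  refine MeasurableSet.iUnion fun t => MeasurableSet.inter ?_ ?_
  · exact measurableSet_lt ((S t).JE_meas.comp RDh.meas_coe) measurable_const
  · exact measurableSet_lt (((S t).DE_meas hT).comp RDh.meas_coe) hf.ennreal_ofReal

lemma RDh.upper {X : Type*} [MetricSpace X] [CompactSpace X] [MeasurableSpace X] [BorelSpace X]
    (d : ℕ) (hd : 0 < d) (T : (Fin d → ℝ) → X → X) (hT : IsContAction d T)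
    (lam : Measure (InvM X d T)) [IsProbabilityMeasure lam]
    (μ : Measure X) [IsProbabilityMeasure μ]
    (hμ : μ = lam.bind fun ν => (ν.1 : Measure X))
    (ε : ℝ) (f : InvM X d T → ℝ) (hf : Measurable f)
    (hfε : (∫⁻ ν, ENNReal.ofReal (f ν) ∂lam) ≤ ENNReal.ofReal ε) :
    RD d T μ ε ≤ ∫⁻ ν, RD d T (ν.1 : Measure X) (f ν) ∂lam := by
  classical
  obtain ⟨x0⟩ : Nonempty X := nonempty_of_isProbabilityMeasure μ
  have hne : Nonempty X := ⟨x0⟩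
  obtain ⟨S, hS⟩ := RDh.countable_family (X := X) hT
  set F : InvM X d T → ℝ≥0∞ := fun ν => RD d T (ν.1 : Measure X) (f ν) with hF
  have hFm : Measurable F := RDh.RD_meas hd hT S hS f hf
  refine ENNReal.le_of_forall_pos_le_add fun δ hδ hfin => ?_
  have hJm : ∀ t, Measurable fun ν : InvM X d T => (S t).JE (ν.1 : Measure X) := fun t =>
    (S t).JE_meas.comp RDh.meas_coe
  have hDm : ∀ t, Measurable fun ν : InvM X d T => (S t).DE T (ν.1 : Measure X) := fun t =>
    ((S t).DE_meas hT).comp RDh.meas_coe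
  set G : ℕ → Set (InvM X d T) := fun t =>
    {ν | (S t).JE (ν.1 : Measure X) < F ν + δ} ∩
      {ν | (S t).DE T (ν.1 : Measure X) < ENNReal.ofReal (f ν)} with hG
  have hGm : ∀ t, MeasurableSet (G t) := fun t =>
    (measurableSet_lt (hJm t) (hFm.add_const _)).inter
      (measurableSet_lt (hDm t) hf.ennreal_ofReal)
  set E : ℕ → Set (InvM X d T) := disjointed G with hE
  have hEm : ∀ t, MeasurableSet (E t) := fun t => MeasurableSet.disjointed hGm t
  have hEG : ∀ t, E t ⊆ G t := fun t => disjointed_subset G t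
  have hEd : Pairwise (Function.onFun Disjoint E) := disjoint_disjointed G
  have hae : ∀ᵐ ν ∂lam, ν ∈ ⋃ t, E t := by
    filter_upwards [ae_lt_top hFm hfin.ne] with ν hν
    rw [hE, iUnion_disjointed]
    have : F ν < F ν + δ := ENNReal.lt_add_right hν.ne (by exact_mod_cast hδ.ne')
    obtain ⟨t, h1, h2⟩ := hS (ν.1 : Measure X) (f ν) _ this
    exact mem_iUnion.2 ⟨t, h1, h2⟩
  -- the total distortion on the pieces
  set D : InvM X d T → ℝ≥0∞ := fun ν =>
    ∑' t, (E t).indicator (fun ν => (S t).DE T (ν.1 : Measure X)) ν with hD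
  have hDlt : ∀ᵐ ν ∂lam, D ν < ENNReal.ofReal (f ν) := by
    filter_upwards [hae] with ν hν
    obtain ⟨t, ht⟩ := mem_iUnion.1 hν
    have : D ν = (S t).DE T (ν.1 : Measure X) := by
      simp only [hD]
      rw [tsum_eq_single t]
      · rw [indicator_of_mem ht]
      · intro t' ht'
        exact indicator_of_notMem (fun h => Set.disjoint_left.1 (hEd ht') h ht) _
    rw [this]
    exact (hEG t ht).2
  have hDint : ∫⁻ ν, D ν ∂lam = ∑' t, ∫⁻ ν in E t, (S t).DE T (ν.1 : Measure X) ∂lam := by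
    simp only [hD]
    rw [lintegral_tsum fun t => ((hDm t).indicator (hEm t)).aemeasurable]
    refine tsum_congr fun t => lintegral_indicator (hEm t) _
  have hDe : ∫⁻ ν, D ν ∂lam < ENNReal.ofReal ε := by
    refine lt_of_lt_of_le ?_ hfε
    refine lintegral_strict_mono (IsProbabilityMeasure.ne_zero lam) hf.ennreal_ofReal.aemeasurable
      ?_ hDlt
    refine ne_top_of_le_ne_top (ENNReal.ofReal_ne_top (r := ε)) (le_trans ?_ hfε)
    exact lintegral_mono_ae (hDlt.mono fun _ h => h.le)
  -- the remainder
  set Rm : ℕ → Set (InvM X d T) := fun N => (⋃ t : Fin N, E t)ᶜ with hRm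
  have hRmm : ∀ N, MeasurableSet (Rm N) := fun N => (MeasurableSet.iUnion fun t => hEm _).compl
  have hR0 : Tendsto (fun N => lam (Rm N)) atTop (𝓝 0) := by
    have hanti : Antitone Rm := by
      intro N N' h
      refine compl_subset_compl.2 (iUnion_subset fun t => ?_)
      exact subset_iUnion (fun t : Fin N' => E t) (Fin.castLE h t)
    have := tendsto_measure_iInter_atTop (μ := lam) (fun N => (hRmm N).nullMeasurableSet) hanti
      ⟨0, measure_ne_top _ _⟩
    have h0 : lam (⋂ N, Rm N) = 0 := by
      refine measure_mono_null ?_ (mem_ae_iff.1 hae)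
      intro ν hν hν'
      obtain ⟨t, ht⟩ := mem_iUnion.1 hν'
      exact (mem_iInter.1 hν (t + 1)) (mem_iUnion.2 ⟨⟨t, Nat.lt_succ_self t⟩, ht⟩)
    rwa [h0] at this
  have hR1 : Tendsto (fun N => ∫⁻ ν, D ν ∂lam +
      ENNReal.ofReal (Metric.diam (univ : Set X)) * lam (Rm N)) atTop
      (𝓝 (∫⁻ ν, D ν ∂lam + ENNReal.ofReal (Metric.diam (univ : Set X)) * 0)) :=
    tendsto_const_nhds.add (ENNReal.Tendsto.const_mul hR0 (Or.inr ENNReal.ofReal_ne_top))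
  rw [mul_zero, add_zero] at hR1
  obtain ⟨N, hN⟩ := (hR1.eventually (gt_mem_nhds hDe)).exists
  have hpair : Pairwise (Function.onFun Disjoint fun t : Fin N => E t) :=
    fun t t' h => hEd (fun h' => h (Fin.ext h'))
  have hsplit : ∀ g : InvM X d T → ℝ≥0∞,
      ∑ t : Fin N, ∫⁻ ν in E t, g ν ∂lam = ∫⁻ ν in ⋃ t : Fin N, E t, g ν ∂lam := by
    intro g
    rw [lintegral_iUnion (fun t => hEm _) hpair, tsum_fintype]
  let s : Option (Fin N) → RDh.Sch (X := X) d := fun o =>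
    match o with
    | none => RDh.constSch d x0
    | some t => S t
  let B : Option (Fin N) → Set (InvM X d T) := fun o =>
    match o with
    | none => Rm N
    | some t => E t
  let M : Option (Fin N) → Measure X := fun o =>
    (lam.restrict (B o)).bind fun ν => (ν.1 : Measure X)
  have key := RDh.RD_le hd hT s M μ (by
    ext A hA
    rw [Measure.finsetSum_apply, hμ, Measure.bind_apply hA RDh.meas_coe.aemeasurable,
      Fintype.sum_option]
    simp only [M, Measure.bind_apply hA RDh.meas_coe.aemeasurable, B]
    rw [hsplit fun ν => (ν.1 : Measure X) A, add_comm, hRm]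
    exact lintegral_add_compl _ (MeasurableSet.iUnion fun t => hEm _))
    (fun o => RDh.bind_inv hT _) ε (by
    refine lt_of_le_of_lt ?_ hN
    rw [Fintype.sum_option, add_comm]
    refine add_le_add ?_ ?_
    · simp only [M, s, B, fun t => (S t).DE_bind hT]
      rw [hDint, Fin.sum_univ_eq_sum_range
        (fun t => ∫⁻ ν in E t, (S t).DE T (ν.1 : Measure X) ∂lam) N]
      exact ENNReal.sum_le_tsum _
    · refine ((s none).DE_le T _).trans (le_of_eq ?_)
      simp only [M, B]
      rw [Measure.bind_apply MeasurableSet.univ RDh.meas_coe.aemeasurable]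
      simp)
  refine key.trans ?_
  have hnone : (s none).JE (M none) = 0 := RDh.constSch_JE d x0 _
  rw [Fintype.sum_option, hnone, zero_add]
  simp only [s, M, B, RDh.Sch.JE_bind]
  calc _ ≤ ∑ t : Fin N, ∫⁻ ν in E t, (F ν + δ) ∂lam := by
        refine Finset.sum_le_sum fun t _ => ?_
        exact setLIntegral_mono (hFm.add_const _) fun ν hν => (hEG t hν).1.le
    _ = ∫⁻ ν in ⋃ t : Fin N, E t, (F ν + δ) ∂lam := hsplit _
    _ ≤ ∫⁻ ν, (F ν + δ) ∂lam := setLIntegral_le_lintegral _ _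
    _ = _ := by
        rw [lintegral_add_left hFm, lintegral_const, measure_univ, mul_one]

/-- Theorem 3.9: formula for the rate distortion function of a barycenter of invariant
measures. -/
theorem RD_barycenter_eq_inf
    {X : Type*} [MetricSpace X] [CompactSpace X] [MeasurableSpace X] [BorelSpace X]
    (d : ℕ) (hd : 0 < d) (T : (Fin d → ℝ) → X → X) (hT : IsContAction d T)
    (lam : Measure (InvM X d T)) [IsProbabilityMeasure lam]
    (μ : Measure X) [IsProbabilityMeasure μ] (hμinv : MeasInvariant d T μ)
    (hbar : ∀ A : Set X, MeasurableSet A → μ A = ∫⁻ ν, (ν.1 : Measure X) A ∂lam)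
    (ε : ℝ) (hε : 0 < ε) :
    RD d T μ ε =
      sInf {r : ℝ≥0∞ | ∃ f : InvM X d T → ℝ, Measurable f ∧ (∀ ν, 0 < f ν) ∧
        (∫⁻ ν, ENNReal.ofReal (f ν) ∂lam) ≤ ENNReal.ofReal ε ∧
        r = ∫⁻ ν, RD d T (ν.1 : Measure X) (f ν) ∂lam} := by
  have hμ : μ = lam.bind fun ν => (ν.1 : Measure X) := by
    ext A hA
    rw [hbar A hA, Measure.bind_apply hA RDh.meas_coe.aemeasurable]
  refine le_antisymm ?_ ?_
  · refine le_sInf ?_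
    rintro r ⟨f, hf, -, hfε, rfl⟩
    exact RDh.upper d hd T hT lam μ hμ ε f hf hfε
  · by_contra hlt
    obtain ⟨f, hf, hf0, hfε, hlt'⟩ := RDh.lower d hd T hT lam μ hμ ε _ (not_le.1 hlt)
    refine absurd (sInf_le ?_) (not_le.2 hlt')
    exact ⟨f, hf, hf0, hfε, rfl⟩
end

section
/- Let d be a positive integer, V a Banach space with closed unit ball B, and equip the space C(ℝ^d, B) of continuous maps ℝ^d → B with the metric 𝐝(x, y) = sup_{n≥1} ( 2^{−n} sup_{|u|_∞ ≤ n} ‖x(u) − y(u)‖ ), with shift action (T^s x)(t) = x(t + s). Let L be a positive integer, s ∈ [0,1)^d, x ∈ C(ℝ^d, B), and let y : [0,L)^d → C(ℝ^d, B), t ↦ y_t, be a Borel measurable map whose range is contained in a compact subset of (C(ℝ^d,B), 𝐝). Then ∫_{[0,L)^d} 𝐝(T^t x, y_t) dm(t) ≥ (1/2) Σ_{𝐧 ∈ ℤ^d ∩ [0,L)^d} ‖ x(s + 𝐧) − ∫_{𝐧 + [0,1)^d} y_t(s + 𝐧 − t) dm(t) ‖, where the inner integral is a V-valued Bochner integral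 and m is Lebesgue measure on ℝ^d. -/
open MeasureTheory Filter Set
open scoped ENNReal Topology NNReal

noncomputable section

/-- The metric `𝐝(x,y) = sup_{n ≥ 1} ( 2^{-n} sup_{|u|_∞ ≤ n} ‖x(u) - y(u)‖ )` on maps
`ℝ^d → V`.  (Note that the norm of `Fin d → ℝ` is exactly the max-norm `|·|_∞`.) -/
def shiftDist {d : ℕ} {V : Type*} [NormedAddCommGroup V]
    (x y : (Fin d → ℝ) → V) : ℝ :=
  ⨆ n : {n : ℕ // 1 ≤ n},
    (2 : ℝ) ^ (-(n.1 : ℝ)) * ⨆ u : {u : Fin d → ℝ // ‖u‖ ≤ (n.1 : ℝ)}, ‖x u.1 - y u.1‖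

/-- The Borel σ-algebra on the space of continuous maps `ℝ^d → V`, equipped with the
compact-open topology (= the topology of uniform convergence on compact sets, which is the
topology induced by the metric `shiftDist` on the set of maps into the unit ball `B`). -/
instance contMapMeasurableSpace {d : ℕ} {V : Type*} [NormedAddCommGroup V] :
    MeasurableSpace C((Fin d → ℝ), V) := borel _

end


theorem aux_inner_le {d : ℕ} {V : Type*} [NormedAddCommGroup V]
    (f g : (Fin d → ℝ) → V) (hf : ∀ u, ‖f u‖ ≤ 1) (hg : ∀ u, ‖g u‖ ≤ 1)
    (u : Fin d → ℝ) : ‖f u - g u‖ ≤ 2 := by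
  have := norm_sub_le (f u) (g u)
  have := hf u
  have := hg u
  linarith

theorem aux_sup_le {d : ℕ} {V : Type*} [NormedAddCommGroup V]
    (f g : (Fin d → ℝ) → V) (hf : ∀ u, ‖f u‖ ≤ 1) (hg : ∀ u, ‖g u‖ ≤ 1)
    (n : {n : ℕ // 1 ≤ n}) :
    (2 : ℝ) ^ (-(n.1 : ℝ)) * ⨆ u : {u : Fin d → ℝ // ‖u‖ ≤ (n.1 : ℝ)}, ‖f u.1 - g u.1‖ ≤ 2 := by
  have h1 : (2 : ℝ) ^ (-(n.1 : ℝ)) ≤ 1 :=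
    Real.rpow_le_one_of_one_le_of_nonpos (by norm_num) (by simp)
  have h2 : (⨆ u : {u : Fin d → ℝ // ‖u‖ ≤ (n.1 : ℝ)}, ‖f u.1 - g u.1‖) ≤ 2 :=
    Real.iSup_le (fun u => aux_inner_le f g hf hg u.1) (by norm_num)
  have h3 : 0 ≤ (⨆ u : {u : Fin d → ℝ // ‖u‖ ≤ (n.1 : ℝ)}, ‖f u.1 - g u.1‖) :=
    Real.iSup_nonneg fun _ => norm_nonneg _
  have h4 : (0 : ℝ) ≤ (2 : ℝ) ^ (-(n.1 : ℝ)) := by positivity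
  nlinarith

theorem shiftDist_nonneg_aux {d : ℕ} {V : Type*} [NormedAddCommGroup V]
    (f g : (Fin d → ℝ) → V) : 0 ≤ shiftDist f g :=
  Real.iSup_nonneg fun _ => mul_nonneg (by positivity) (Real.iSup_nonneg fun _ => norm_nonneg _)

theorem shiftDist_le_two {d : ℕ} {V : Type*} [NormedAddCommGroup V]
    (f g : (Fin d → ℝ) → V) (hf : ∀ u, ‖f u‖ ≤ 1) (hg : ∀ u, ‖g u‖ ≤ 1) :
    shiftDist f g ≤ 2 :=
  Real.iSup_le (aux_sup_le f g hf hg) (by norm_num)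

theorem half_le_shiftDist {d : ℕ} {V : Type*} [NormedAddCommGroup V]
    (f g : (Fin d → ℝ) → V) (hf : ∀ u, ‖f u‖ ≤ 1) (hg : ∀ u, ‖g u‖ ≤ 1)
    (u : Fin d → ℝ) (hu : ‖u‖ ≤ 1) : (1 / 2 : ℝ) * ‖f u - g u‖ ≤ shiftDist f g := by
  have hb : BddAbove (range fun n : {n : ℕ // 1 ≤ n} => (2 : ℝ) ^ (-(n.1 : ℝ)) *
      ⨆ u : {u : Fin d → ℝ // ‖u‖ ≤ (n.1 : ℝ)}, ‖f u.1 - g u.1‖) :=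
    ⟨2, by rintro _ ⟨n, rfl⟩; exact aux_sup_le f g hf hg n⟩
  refine le_trans ?_ (le_ciSup hb ⟨1, le_rfl⟩)
  have e : (2 : ℝ) ^ (-((1 : ℕ) : ℝ)) = 1 / 2 := by
    rw [Nat.cast_one, Real.rpow_neg_one]; norm_num
  simp only [e]
  refine mul_le_mul_of_nonneg_left ?_ (by norm_num)
  have hb2 : BddAbove (range fun u : {u : Fin d → ℝ // ‖u‖ ≤ ((1 : ℕ) : ℝ)} => ‖f u.1 - g u.1‖) :=
    ⟨2, by rintro _ ⟨n, rfl⟩; exact aux_inner_le f g hf hg n.1⟩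
  exact le_ciSup hb2 ⟨u, by simpa using hu⟩

theorem aux_stronglyMeasurable {d : ℕ} {V : Type*} [NormedAddCommGroup V]
    (y : (Fin d → ℝ) → C((Fin d → ℝ), V))
    (hym : Measurable y)
    (K : Set C((Fin d → ℝ), V)) (hK : IsCompact K) (hyK : Set.range y ⊆ K) :
    StronglyMeasurable y := by
  have : BorelSpace C((Fin d → ℝ), V) := ⟨rfl⟩
  have : TopologicalSpace.PseudoMetrizableSpace C((Fin d → ℝ), V) := inferInstance
  exact stronglyMeasurable_iff_measurable_separable.2 ⟨hym, hK.isSeparable.mono hyK⟩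

theorem aux_eval {d : ℕ} {V : Type*} [NormedAddCommGroup V]
    (y : (Fin d → ℝ) → C((Fin d → ℝ), V)) (hy : StronglyMeasurable y) (p : Fin d → ℝ) :
    StronglyMeasurable fun t => y t (p - t) := by
  have h1 : StronglyMeasurable fun t : Fin d → ℝ => p - t :=
    (continuous_const.sub continuous_id).stronglyMeasurable
  have hc : Continuous fun q : C((Fin d → ℝ), V) × (Fin d → ℝ) => q.1 q.2 := by fun_prop
  exact hc.comp_stronglyMeasurable (hy.prodMk h1)

theorem aux_dist_meas {d : ℕ} {V : Type*} [NormedAddCommGroup V]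
    (x : (Fin d → ℝ) → V) (hxc : Continuous x)
    (y : (Fin d → ℝ) → C((Fin d → ℝ), V)) (hy : StronglyMeasurable y) :
    Measurable fun t => shiftDist (fun u => x (u + t)) (⇑(y t)) := by
  unfold shiftDist
  refine Measurable.iSup fun n => Measurable.const_mul ?_ _
  let X : C((Fin d → ℝ), C((Fin d → ℝ), V)) :=
    ContinuousMap.curry ⟨fun q : (Fin d → ℝ) × (Fin d → ℝ) => x (q.2 + q.1), by fun_prop⟩
  let S : Set (Fin d → ℝ) := {u | ‖u‖ ≤ (n.1 : ℝ)}
  have : CompactSpace S := by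
    rw [← isCompact_iff_compactSpace]
    have : S = Metric.closedBall 0 (n.1 : ℝ) := by ext; simp [S]
    rw [this]; exact isCompact_closedBall _ _
  have hc : Continuous fun F : C((Fin d → ℝ), V) => F.restrict S :=
    ContinuousMap.continuous_restrict S
  have h1 : StronglyMeasurable fun t => (X t).restrict S :=
    (hc.comp X.continuous).stronglyMeasurable
  have h2 : StronglyMeasurable fun t => (y t).restrict S := hc.comp_stronglyMeasurable hy
  have h3 := (h1.sub h2).norm.measurable
  have h4 : (fun t => ⨆ u : {u : Fin d → ℝ // ‖u‖ ≤ (n.1 : ℝ)}, ‖x (u.1 + t) - y t u.1‖) =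
      fun t => ‖(X t).restrict S - (y t).restrict S‖ := by
    funext t
    exact (ContinuousMap.norm_eq_iSup_norm ((X t).restrict S - (y t).restrict S)).symm
  rw [h4]
  exact h3

theorem aux_cubes {d : ℕ} (L : ℕ) :
    Set.univ.pi (fun _ : Fin d => Set.Ico (0 : ℝ) (L : ℝ)) =
      ⋃ n : Fin d → Fin L,
        Set.univ.pi (fun i => Set.Ico ((n i : ℕ) : ℝ) (((n i : ℕ) : ℝ) + 1)) := by
  ext t
  simp only [mem_iUnion, mem_univ_pi, mem_Ico]
  constructor
  · intro h
    refine ⟨fun i => ⟨⌊t i⌋₊, (Nat.floor_lt (h i).1).2 (h i).2⟩, fun i => ?_⟩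
    exact ⟨Nat.floor_le (h i).1, Nat.lt_floor_add_one _⟩
  · rintro ⟨n, h⟩ i
    refine ⟨le_trans (Nat.cast_nonneg _) (h i).1, lt_of_lt_of_le (h i).2 ?_⟩
    exact_mod_cast (n i).2

theorem aux_disj {d : ℕ} (L : ℕ) :
    Pairwise (Function.onFun Disjoint fun n : Fin d → Fin L =>
        Set.univ.pi (fun i => Set.Ico ((n i : ℕ) : ℝ) (((n i : ℕ) : ℝ) + 1))) := by
  intro a b hab
  refine Set.disjoint_left.2 fun t ha hb => hab ?_
  simp only [mem_univ_pi, mem_Ico] at ha hb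
  funext i
  apply Fin.ext
  have h1 : ((a i : ℕ) : ℝ) < (b i : ℕ) + 1 := lt_of_le_of_lt (ha i).1 (hb i).2
  have h2 : ((b i : ℕ) : ℝ) < (a i : ℕ) + 1 := lt_of_le_of_lt (hb i).1 (ha i).2
  have h3 : (a i : ℕ) < (b i : ℕ) + 1 := by exact_mod_cast h1
  have h4 : (b i : ℕ) < (a i : ℕ) + 1 := by exact_mod_cast h2
  omega

/-- Lemma 4.4: the distortion estimate.  Here `x` ranges in the unit ball `B` of the Banach
space `V`, `T^t x = x(· + t)` is the shift action, and `y : [0,L)^d → C(ℝ^d, B)` is a Borel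
measurable map with range in a compact set.  The inner integral is a `V`-valued Bochner
integral over the cube `𝐧 + [0,1)^d`, and the cubes are indexed by `𝐧 ∈ ℤ^d ∩ [0,L)^d`. -/
theorem distortion_estimate {d : ℕ} (hd : 0 < d)
    {V : Type*} [NormedAddCommGroup V] [NormedSpace ℝ V] [CompleteSpace V]
    (L : ℕ) (hL : 0 < L) (s : Fin d → ℝ) (hs : ∀ i, 0 ≤ s i ∧ s i < 1)
    (x : (Fin d → ℝ) → V) (hxc : Continuous x) (hxb : ∀ t, ‖x t‖ ≤ 1)
    (y : (Fin d → ℝ) → C((Fin d → ℝ), V)) (hyb : ∀ t u, ‖y t u‖ ≤ 1)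
    (hym : Measurable y)
    (K : Set C((Fin d → ℝ), V)) (hK : IsCompact K) (hyK : Set.range y ⊆ K) :
    (1 / 2 : ℝ) * ∑ n : Fin d → Fin L,
        ‖x (s + fun i => ((n i : ℕ) : ℝ)) -
          ∫ t in Set.univ.pi (fun i => Set.Ico ((n i : ℕ) : ℝ) (((n i : ℕ) : ℝ) + 1)),
            y t ((s + fun i => ((n i : ℕ) : ℝ)) - t) ∂volume‖
      ≤ ∫ t in Set.univ.pi (fun _ : Fin d => Set.Ico (0 : ℝ) (L : ℝ)),
          shiftDist (fun u => x (u + t)) (⇑(y t)) ∂volume := by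
  have hy := aux_stronglyMeasurable y hym K hK hyK
  have hmeas : ∀ n : Fin d → Fin L, MeasurableSet
      (Set.univ.pi (fun i => Set.Ico ((n i : ℕ) : ℝ) (((n i : ℕ) : ℝ) + 1))) :=
    fun n => MeasurableSet.univ_pi fun i => measurableSet_Ico
  have hvol : ∀ n : Fin d → Fin L, volume
      (Set.univ.pi (fun i => Set.Ico ((n i : ℕ) : ℝ) (((n i : ℕ) : ℝ) + 1))) = 1 := by
    intro n
    rw [Real.volume_pi_Ico]
    simp
  have hdist : ∀ n : Fin d → Fin L, IntegrableOn
      (fun t => shiftDist (fun u => x (u + t)) (⇑(y t)))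
      (Set.univ.pi (fun i => Set.Ico ((n i : ℕ) : ℝ) (((n i : ℕ) : ℝ) + 1))) volume := by
    intro n
    refine Measure.integrableOn_of_bounded (M := 2) (by rw [hvol]; simp)
      (aux_dist_meas x hxc y hy).aestronglyMeasurable (ae_of_all _ fun t => ?_)
    rw [Real.norm_of_nonneg (shiftDist_nonneg_aux _ _)]
    exact shiftDist_le_two _ _ (fun u => hxb _) (hyb t)
  rw [aux_cubes, integral_iUnion_fintype hmeas (aux_disj L) hdist, Finset.mul_sum]
  refine Finset.sum_le_sum fun n _ => ?_
  set p : Fin d → ℝ := s + fun i => ((n i : ℕ) : ℝ) with hp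
  set Q := Set.univ.pi (fun i => Set.Ico ((n i : ℕ) : ℝ) (((n i : ℕ) : ℝ) + 1)) with hQ
  have hyint : IntegrableOn (fun t => y t (p - t)) Q volume :=
    Measure.integrableOn_of_bounded (M := 1) (by rw [hvol]; simp)
      (aux_eval y hy p).aestronglyMeasurable (ae_of_all _ fun t => hyb _ _)
  have hxint : IntegrableOn (fun _ : Fin d → ℝ => x p) Q volume :=
    integrableOn_const (by rw [hvol]; simp)
  have e : x p - ∫ t in Q, y t (p - t) = ∫ t in Q, (x p - y t (p - t)) := by
    rw [integral_sub hxint hyint, setIntegral_const, measureReal_def, hvol]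
    simp
  rw [e]
  calc (1 / 2 : ℝ) * ‖∫ t in Q, (x p - y t (p - t))‖
      ≤ (1 / 2 : ℝ) * ∫ t in Q, ‖x p - y t (p - t)‖ := by
        gcongr
        exact norm_integral_le_integral_norm _
    _ = ∫ t in Q, (1 / 2 : ℝ) * ‖x p - y t (p - t)‖ := (integral_const_mul _ _).symm
    _ ≤ _ := by
        refine setIntegral_mono_on ((hxint.sub hyint).norm.const_mul _) (hdist n) (hmeas n) ?_
        intro t ht
        simp only [hQ, mem_univ_pi, mem_Ico] at ht
        have hu : ‖p - t‖ ≤ 1 := by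
          rw [pi_norm_le_iff_of_nonneg zero_le_one]
          intro i
          have h1 := ht i
          have h2 := hs i
          simp only [hp, Pi.sub_apply, Pi.add_apply, Real.norm_eq_abs, abs_le]
          constructor <;> linarith [h1.1, h1.2, h2.1, h2.2]
        have := half_le_shiftDist (fun u => x (u + t)) (⇑(y t)) (fun u => hxb _) (hyb t) (p - t) hu
        simpa using this
end

section
/- There exists a positive constant K (independent of all data below, e.g. K = 2 + Σ_{j≥0} 2^j·2^{−2^j}) with the following property. Let a_1 < b_1 < a_2 < b_2 < ⋯ be natural numbers with b_k > k² a_k for all k ≥ 1, set c_k = k·a_k, and define h : ℕ → ℕ by h(n) = n if n ≤ a_1 or n ∈ [a_k, c_k] for some k ≥ 1, and h(n) = a_{k+1} if n ∈ (c_k, a_{k+1}] for some k ≥ 1. Let Λ = {0,1}^ℕ, let p be the product over ℕ of the uniform measure (½δ_0 + ½δ_1) on {0,1}, and let φ : Λ → ℓ^∞(ℕ) be φ(v) = (2^{−h(m)} v_m)_{m≥1}. Then there exists k_0 (depending only on the sequence, not on z) such that for every k ≥ k_0 and every z ∈ ℓ^∞(ℕ), ∫_Λ 2^{−2^{c_k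 + 1} ‖φ(v) − z‖_∞} dp(v) ≤ K · 2^{−c_k}. -/
open MeasureTheory
open scoped ENNReal NNReal

noncomputable section

/-- `‖φ(v) - z‖_{ℓ^∞}` where `φ(v) = (2^{-h(m)} v_m)_{m ≥ 1}`: the supremum over `m ≥ 1` of
`|2^{-h(m)} v_m - z_m|`. -/
def supDist1 (h : ℕ → ℕ) (v : ℕ → Bool) (z : ℕ → ℝ) : ℝ :=
  ⨆ m : {m : ℕ // 1 ≤ m}, |(2 : ℝ) ^ (-(h m.1 : ℝ)) * (if v m.1 then 1 else 0) - z m.1|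

end

lemma aux_h (a b h : ℕ → ℕ)
    (hab : ∀ k, 1 ≤ k → a k < b k ∧ b k < a (k + 1) ∧ k ^ 2 * a k < b k)
    (h1 : ∀ n : ℕ, n ≤ a 1 → h n = n)
    (h2 : ∀ n k : ℕ, 1 ≤ k → a k ≤ n → n ≤ k * a k → h n = n)
    (h3 : ∀ n k : ℕ, 1 ≤ k → k * a k < n → n ≤ a (k + 1) → h n = a (k + 1))
    (k : ℕ) (hk : 1 ≤ k) : ∀ m, m ≤ a k → h m ≤ a k := by
  induction k, hk using Nat.le_induction with
  | base => intro m hm; rw [h1 m hm]; exact hm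
  | succ k hk ih =>
    intro m hm
    have := hab k hk
    rcases le_or_gt m (a k) with h4 | h4
    · have := ih m h4; omega
    · rcases le_or_gt m (k * a k) with h5 | h5
      · rw [h2 m k hk h4.le h5]; exact hm
      · rw [h3 m k hk h5 hm]

open Classical in
/-- The cylinder of sequences which agree with the best guess for `z` up to `j`. -/
def cyl (h : ℕ → ℕ) (z : ℕ → ℝ) (j : ℕ) : Set (ℕ → Bool) :=
  {v | ∀ m ∈ Finset.Icc 1 j, v m = decide ((2 : ℝ) ^ (-(h m : ℝ)) / 2 < z m)}

lemma cyl_meas (h : ℕ → ℕ) (z : ℕ → ℝ) (j : ℕ) : MeasurableSet (cyl h z j) := by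
  have : cyl h z j = ⋂ m ∈ Finset.Icc 1 j, (fun v : ℕ → Bool => v m) ⁻¹'
      {w | w = @decide ((2 : ℝ) ^ (-(h m : ℝ)) / 2 < z m) (Classical.propDecidable _)} := by
    ext v; simp [cyl]
  rw [this]
  exact Finset.measurableSet_biInter _ fun m _ => measurable_pi_apply m (MeasurableSet.of_discrete)

lemma supDist_ge (h : ℕ → ℕ) (z : ℕ → ℝ) (hz : ∃ C : ℝ, ∀ m, |z m| ≤ C) (j : ℕ)
    (hj : ∀ m, m ≤ j → h m ≤ j) (v : ℕ → Bool) (hv : v ∉ cyl h z j) :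
    (2 : ℝ) ^ (-(j : ℝ)) / 2 ≤ supDist1 h v z := by
  obtain ⟨C, hC⟩ := hz
  have hb : BddAbove (Set.range fun m : {m : ℕ // 1 ≤ m} =>
      |(2 : ℝ) ^ (-(h m.1 : ℝ)) * (if v m.1 then 1 else 0) - z m.1|) := by
    refine ⟨1 + C, ?_⟩
    rintro _ ⟨m, rfl⟩
    have h0 : (0 : ℝ) < (2 : ℝ) ^ (-(h m.1 : ℝ)) := by positivity
    have h1 : (2 : ℝ) ^ (-(h m.1 : ℝ)) ≤ 1 :=
      Real.rpow_le_one_of_one_le_of_nonpos (by norm_num) (by simp)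
    have h2 := abs_le.1 (hC m.1)
    dsimp only
    rw [abs_le]
    split_ifs <;> constructor <;> linarith
  simp only [cyl, Set.mem_ofPred_eq, not_forall] at hv
  obtain ⟨m, hm, hvm⟩ := hv
  rw [Finset.mem_Icc] at hm
  have h4 : (2 : ℝ) ^ (-(j : ℝ)) ≤ (2 : ℝ) ^ (-(h m : ℝ)) := by
    apply Real.rpow_le_rpow_of_exponent_le (by norm_num)
    have : (h m : ℝ) ≤ j := by exact_mod_cast hj m hm.2
    linarith
  refine le_trans ?_ (le_ciSup hb ⟨m, hm.1⟩)
  dsimp only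
  by_cases hd : (2 : ℝ) ^ (-(h m : ℝ)) / 2 < z m
  · have : v m = false := by rw [decide_eq_true hd] at hvm; simpa using hvm
    rw [this, le_abs]
    right
    simp only [Bool.false_eq_true, if_false]
    linarith
  · have : v m = true := by rw [decide_eq_false hd] at hvm; simpa using hvm
    rw [this, le_abs]
    left
    simp only [if_true]
    linarith

lemma integrand_le (c j : ℕ) (hjc : j ≤ c) (r : ℝ) (hr : (2 : ℝ) ^ (-(j : ℝ)) / 2 ≤ r) :
    ENNReal.ofReal ((2 : ℝ) ^ (-((2 : ℝ) ^ ((c : ℝ) + 1) * r))) ≤ (1 / 2 : ℝ≥0∞) ^ (2 ^ (c - j)) := by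
  have e : (1 / 2 : ℝ≥0∞) ^ (2 ^ (c - j)) = ENNReal.ofReal ((2 : ℝ) ^ (-((2 ^ (c - j) : ℕ) : ℝ))) := by
    rw [Real.rpow_neg (by norm_num), Real.rpow_natCast, ENNReal.ofReal_inv_of_pos (by positivity),
      ENNReal.ofReal_pow (by norm_num), one_div, ENNReal.inv_pow]
    simp
  rw [e]
  apply ENNReal.ofReal_le_ofReal
  apply Real.rpow_le_rpow_of_exponent_le (by norm_num)
  have h1 : (2 : ℝ) ^ ((c : ℝ) + 1) * ((2 : ℝ) ^ (-(j : ℝ)) / 2) = ((2 ^ (c - j) : ℕ) : ℝ) := by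
    obtain ⟨d, rfl⟩ := Nat.exists_eq_add_of_le hjc
    rw [Nat.add_sub_cancel_left, Real.rpow_add (by norm_num), Real.rpow_neg (by norm_num),
      Real.rpow_natCast, Real.rpow_natCast]
    push_cast
    rw [pow_add]
    field_simp
    simp
  have h2 := mul_le_mul_of_nonneg_left hr (show (0 : ℝ) ≤ (2 : ℝ) ^ ((c : ℝ) + 1) by positivity)
  linarith

lemma pointwise (F : (ℕ → Bool) → ℝ≥0∞) (E : ℕ → Set (ℕ → Bool)) (W : ℕ → ℝ≥0∞) (A c : ℕ)
    (hF1 : ∀ v, F v ≤ 1) (hF : ∀ j, A ≤ j → j ≤ c → ∀ v, v ∉ E j → F v ≤ W j)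
    (n : ℕ) (hn : A ≤ n) (hnc : n ≤ c) (v : ℕ → Bool) :
    F v ≤ W A + ∑ j ∈ Finset.Ico A n, (E j).indicator (fun _ => W (j + 1)) v
      + (E n).indicator (fun _ => 1) v := by
  induction n, hn using Nat.le_induction with
  | base =>
    by_cases hv : v ∈ E A
    · simpa [hv] using le_add_left (hF1 v)
    · simpa [hv] using hF A le_rfl hnc v hv
  | succ n hn ih =>
    by_cases hv : v ∈ E (n + 1)
    · simpa [hv] using le_add_left (hF1 v)
    · have hw := hF (n + 1) (by omega) hnc v hv
      rw [Finset.sum_Ico_succ_top hn]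
      by_cases hv' : v ∈ E n
      · simp only [hv, hv', Set.indicator_of_mem, Set.indicator_of_notMem, not_false_iff, add_zero]
        rw [← add_assoc]
        exact le_add_left hw
      · have := ih (by omega)
        simpa [hv, hv'] using this

lemma weight_le (c j : ℕ) (hj : j < c) :
    (1 / 2 : ℝ≥0∞) ^ (2 ^ (c - (j + 1))) * (1 / 2) ^ j
      ≤ 2 * (1 / 2) ^ c * (1 / 2) ^ (c - 1 - j) := by
  obtain ⟨i, rfl⟩ := Nat.exists_eq_add_of_lt hj
  have e1 : j + i + 1 - (j + 1) = i := by omega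
  have e2 : j + i + 1 - 1 - j = i := by omega
  rw [e1, e2, ← pow_add, mul_assoc, ← pow_add]
  have h2 : (2 : ℝ≥0∞) * (1 / 2) = 1 := by
    rw [one_div]; exact ENNReal.mul_inv_cancel (by simp) (by simp)
  have e3 : j + i + 1 + i = (j + i + i) + 1 := by omega
  rw [e3, pow_succ, mul_comm, mul_assoc, mul_comm (1 / 2 : ℝ≥0∞) 2, h2, mul_one]
  apply pow_le_pow_right_of_le_one' (by simp)
  have : 2 * i ≤ 2 ^ i := by
    rcases i with _ | i
    · simp
    · have := Nat.lt_two_pow_self (n := i)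
      rw [pow_succ]; omega
  omega

lemma sum_le (c A : ℕ) :
    ∑ j ∈ Finset.Ico A c, (1 / 2 : ℝ≥0∞) ^ (2 ^ (c - (j + 1))) * (1 / 2) ^ j
      ≤ 4 * (1 / 2) ^ c := by
  calc _ ≤ ∑ j ∈ Finset.Ico A c, 2 * (1 / 2 : ℝ≥0∞) ^ c * (1 / 2) ^ (c - 1 - j) :=
        Finset.sum_le_sum fun j hj => weight_le c j (Finset.mem_Ico.1 hj).2
    _ ≤ ∑ j ∈ Finset.range c, 2 * (1 / 2 : ℝ≥0∞) ^ c * (1 / 2) ^ (c - 1 - j) := by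
        apply Finset.sum_le_sum_of_subset
        intro j hj
        exact Finset.mem_range.2 (Finset.mem_Ico.1 hj).2
    _ = 2 * (1 / 2 : ℝ≥0∞) ^ c * ∑ j ∈ Finset.range c, (1 / 2) ^ j := by
        rw [← Finset.mul_sum, Finset.sum_range_reflect (fun j => (1 / 2 : ℝ≥0∞) ^ j) c]
    _ ≤ 2 * (1 / 2 : ℝ≥0∞) ^ c * 2 := by
        gcongr
        refine (ENNReal.sum_le_tsum _).trans ?_
        rw [ENNReal.tsum_geometric]
        simp
    _ = _ := by ring

/-- Lemma 5.5: there is a universal constant `K > 0` such that, for any data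
`a₁ < b₁ < a₂ < b₂ < ⋯` with `bₖ > k² aₖ`, `cₖ = k aₖ`, `h` as in the paper,
`p` the unbiased Bernoulli measure on `Λ = {0,1}^ℕ` (characterized by its values on
cylinders) and `φ(v) = (2^{-h(m)} vₘ)ₘ`, for all sufficiently large `k` (uniformly in `z`)
and every `z ∈ ℓ^∞(ℕ)` one has `∫_Λ 2^{-2^{cₖ+1} ‖φ(v) - z‖_∞} dp(v) ≤ K 2^{-cₖ}`. -/
theorem bernoulli_integral_estimate :
    ∃ K : ℝ, 0 < K ∧
      ∀ a b : ℕ → ℕ, (∀ k, 1 ≤ k → a k < b k ∧ b k < a (k + 1) ∧ k ^ 2 * a k < b k) →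
      ∀ h : ℕ → ℕ,
        (∀ n : ℕ, n ≤ a 1 → h n = n) →
        (∀ n k : ℕ, 1 ≤ k → a k ≤ n → n ≤ k * a k → h n = n) →
        (∀ n k : ℕ, 1 ≤ k → k * a k < n → n ≤ a (k + 1) → h n = a (k + 1)) →
      ∀ p : Measure (ℕ → Bool), IsProbabilityMeasure p →
        (∀ (s : Finset ℕ) (f : ℕ → Bool),
          p {v | ∀ m ∈ s, v m = f m} = (1 / 2 : ℝ≥0∞) ^ s.card) →
      ∃ k₀ : ℕ, ∀ k, k₀ ≤ k → 1 ≤ k → ∀ z : ℕ → ℝ, (∃ C : ℝ, ∀ m, |z m| ≤ C) →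
        (∫⁻ v, ENNReal.ofReal
            ((2 : ℝ) ^ (-((2 : ℝ) ^ (((k * a k : ℕ) : ℝ) + 1) * supDist1 h v z))) ∂p)
          ≤ ENNReal.ofReal (K * (2 : ℝ) ^ (-((k * a k : ℕ) : ℝ))) := by
  refine ⟨6, by norm_num, ?_⟩
  intro a b hab h h1 h2 h3 p hp hcyl
  refine ⟨2, ?_⟩
  intro k hk2 hk z hz
  have hA := aux_h a b h hab h1 h2 h3 k hk
  set c := k * a k with hc
  have hAc : a k ≤ c := Nat.le_mul_of_pos_left _ hk
  have hj : ∀ j, a k ≤ j → j ≤ c → ∀ m, m ≤ j → h m ≤ j := by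
    intro j hj1 hj2 m hm
    rcases le_or_gt m (a k) with h4 | h4
    · exact (hA m h4).trans hj1
    · rw [h2 m k hk h4.le (hm.trans hj2)]; exact hm
  have hcm : ∀ j, p (cyl h z j) = (1 / 2 : ℝ≥0∞) ^ j := by
    intro j
    have := hcyl (Finset.Icc 1 j)
      (fun m => @decide ((2 : ℝ) ^ (-(h m : ℝ)) / 2 < z m) (Classical.propDecidable _))
    rw [Nat.card_Icc, Nat.add_sub_cancel] at this
    exact this
  have hpt := pointwise (fun v => ENNReal.ofReal
      ((2 : ℝ) ^ (-((2 : ℝ) ^ ((c : ℝ) + 1) * supDist1 h v z)))) (cyl h z)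
      (fun j => (1 / 2 : ℝ≥0∞) ^ (2 ^ (c - j))) (a k) c
      (by
        intro v
        rw [← ENNReal.ofReal_one]
        apply ENNReal.ofReal_le_ofReal
        apply Real.rpow_le_one_of_one_le_of_nonpos (by norm_num)
        have : 0 ≤ supDist1 h v z := Real.iSup_nonneg fun _ => abs_nonneg _
        have : 0 ≤ (2 : ℝ) ^ ((c : ℝ) + 1) * supDist1 h v z := by positivity
        linarith)
      (fun j hj1 hj2 v hv => integrand_le c j hj2 _ (supDist_ge h z hz j (hj j hj1 hj2) v hv))
      c hAc le_rfl
  have hR : ENNReal.ofReal (6 * (2 : ℝ) ^ (-(c : ℝ))) = 6 * (1 / 2 : ℝ≥0∞) ^ c := by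
    rw [Real.rpow_neg (by norm_num), Real.rpow_natCast, ENNReal.ofReal_mul (by norm_num),
      ENNReal.ofReal_inv_of_pos (by positivity),
      ENNReal.ofReal_pow (by norm_num), one_div, ENNReal.inv_pow]
    simp
  rw [hR]
  refine (lintegral_mono hpt).trans ?_
  have hm : ∀ j, ∀ w : ℝ≥0∞, Measurable ((cyl h z j).indicator (fun _ => w)) :=
    fun j w => measurable_const.indicator (cyl_meas h z j)
  rw [lintegral_add_right _ (hm _ _), lintegral_add_left measurable_const,
    lintegral_finsetSum _ (fun j _ => hm _ _)]
  simp only [lintegral_indicator_const (cyl_meas h z _), hcm, lintegral_const, measure_univ,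
    mul_one, one_mul]
  have hfirst : (1 / 2 : ℝ≥0∞) ^ (2 ^ (c - a k)) ≤ (1 / 2) ^ c := by
    apply pow_le_pow_right_of_le_one' (by simp)
    have h5 : 2 * (c - a k) ≤ 2 ^ (c - a k) := by
      rcases (c - a k) with _ | i
      · simp
      · have := Nat.lt_two_pow_self (n := i)
        rw [pow_succ]; omega
    have h6 : 2 * a k ≤ c := Nat.mul_le_mul_right _ hk2
    omega
  calc _ ≤ (1 / 2 : ℝ≥0∞) ^ c + 4 * (1 / 2) ^ c + (1 / 2) ^ c := by
        gcongr
        exact sum_le c (a k)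
    _ = _ := by ring
end
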